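/- arXiv:1602.06217 — 6 statements merged into one kernel-verified Lean document; each statement's English description precedes it below -/
import Mathlib

section
/- Suppose ρ = 1, α > 0, and there exist constants c > 0 and γ ∈ (1/2, 1] with lim_n n^γ r_n = c. Let Z be the almost sure limit of the martingale Z_n. Then P(Z ∈ {0,1}) < 1, and P(Z = z) = 0 for every z ∈ (0,1). -/
open MeasureTheory Filter Real

noncomputable section

/-- The σ-field `F_n = σ(Z_k(i) : 1 ≤ i ≤ N, 0 ≤ k ≤ n)` generated by the walks up to time `n`. -/
def walkFiltration {Ω : Type*} [MeasurableSpace Ω] {N : ℕ}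
    (Z : ℕ → Fin N → Ω → ℝ) (n : ℕ) : MeasurableSpace Ω :=
  ⨆ k ∈ Finset.range (n + 1), ⨆ i : Fin N, MeasurableSpace.comap (Z k i) (borel ℝ)

/-- The empirical mean `Z_n = N⁻¹ Σ_{i=1}^N Z_n(i)`. -/
def walkMean {Ω : Type*} {N : ℕ} (Z : ℕ → Fin N → Ω → ℝ) (n : ℕ) (ω : Ω) : ℝ :=
  (∑ i : Fin N, Z n i ω) / N

set_option linter.unusedSectionVars false

/-- bounded measurable functions -/
def BM {Ω : Type*} (m : MeasurableSpace Ω) (f : Ω → ℝ) : Prop :=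
  Measurable[m] f ∧ ∃ C, ∀ ω, |f ω| ≤ C

namespace BM
variable {Ω : Type*} {m m' : MeasurableSpace Ω} {f g : Ω → ℝ}

lemma const (c : ℝ) : BM m (fun _ => c) := ⟨measurable_const, |c|, fun _ => le_rfl⟩

lemma add (hf : BM m f) (hg : BM m g) : BM m (fun ω => f ω + g ω) := by
  obtain ⟨a, A, hA⟩ := hf
  obtain ⟨b, B, hB⟩ := hg
  exact ⟨a.add b, A + B, fun ω => (abs_add_le _ _).trans (add_le_add (hA ω) (hB ω))⟩

lemma mul (hf : BM m f) (hg : BM m g) : BM m (fun ω => f ω * g ω) := by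
  obtain ⟨a, A, hA⟩ := hf
  obtain ⟨b, B, hB⟩ := hg
  refine ⟨a.mul b, A * B, fun ω => ?_⟩
  rw [abs_mul]
  exact mul_le_mul (hA ω) (hB ω) (abs_nonneg _) ((abs_nonneg _).trans (hA ω))

lemma sub (hf : BM m f) (hg : BM m g) : BM m (fun ω => f ω - g ω) := by
  have := hf.add ((const (-1)).mul hg)
  convert this using 2
  ring

lemma pow (hf : BM m f) (n : ℕ) : BM m (fun ω => f ω ^ n) := by
  induction n with
  | zero => simpa using const (m := m) 1
  | succ k ih => simpa [pow_succ] using ih.mul hf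

lemma sum {ι : Type*} (s : Finset ι) {f : ι → Ω → ℝ} (hf : ∀ i, BM m (f i)) :
    BM m (fun ω => ∑ i ∈ s, f i ω) := by
  classical
  induction s using Finset.induction_on with
  | empty => simpa using const (m := m) 0
  | insert a s ha ih => simpa [Finset.sum_insert ha] using (hf a).add ih

lemma mono (h : m ≤ m') (hf : BM m f) : BM m' f := ⟨hf.1.mono h le_rfl, hf.2⟩

lemma of01 (hf : Measurable[m] f) (h : ∀ ω, f ω ∈ Set.Icc (0:ℝ) 1) : BM m f :=
  ⟨hf, 1, fun ω => abs_le.2 ⟨by linarith [(h ω).1], (h ω).2⟩⟩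

lemma int [mΩ : MeasurableSpace Ω] {μ : Measure Ω} [IsFiniteMeasure μ] {f : Ω → ℝ} (hf : BM mΩ f) :
    Integrable f μ := by
  obtain ⟨a, A, hA⟩ := hf
  exact Integrable.of_bound a.aestronglyMeasurable A (ae_of_all _ hA)

lemma condInt {F : MeasurableSpace Ω} [mΩ : MeasurableSpace Ω] {μ : Measure Ω} [IsFiniteMeasure μ]
    (hF : F ≤ mΩ) {g Y P : Ω → ℝ} (hg : BM F g) (hY : BM mΩ Y) (h : μ[Y | F] =ᵐ[μ] P) :
    ∫ ω, g ω * Y ω ∂μ = ∫ ω, g ω * P ω ∂μ := by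
  have h1 := condExp_mul_of_stronglyMeasurable_left (m := F) (μ := μ) (f := g) (g := Y)
    hg.1.stronglyMeasurable ((hg.mono hF).mul hY).int hY.int
  calc ∫ ω, g ω * Y ω ∂μ = ∫ ω, (μ[g * Y | F]) ω ∂μ := (integral_condExp hF).symm
    _ = _ := by
      apply integral_congr_ae
      filter_upwards [h1, h] with ω a b
      rw [a, Pi.mul_apply, b]

lemma mle {m : MeasurableSpace Ω} {f : Ω → ℝ} (hf : Measurable f) (c : ℝ) :
    MeasurableSet {ω | c ≤ f ω} := measurableSet_le measurable_const hf

lemma mlt {m : MeasurableSpace Ω} {f : Ω → ℝ} (hf : Measurable f) (c : ℝ) :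
    MeasurableSet {ω | c < f ω} := measurableSet_lt measurable_const hf

lemma mtend {m : MeasurableSpace Ω} {f : ℕ → Ω → ℝ} (hf : ∀ k, Measurable (f k)) (z : ℝ) :
    MeasurableSet {ω | Tendsto (fun k => f k ω) atTop (nhds z)} :=
  measurableSet_tendsto (nhds z) hf

end BM

/-- abstract bounded martingale -/
structure Proc {Ω : Type*} [mΩ : MeasurableSpace Ω] (μ : Measure Ω) (F : ℕ → MeasurableSpace Ω)
    (M X : ℕ → Ω → ℝ) (r : ℕ → ℝ) (κ : ℝ) : Prop where
  le : ∀ n, F n ≤ mΩ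
  mono : Monotone F
  Mm : ∀ n, Measurable[F n] (M n)
  Xm : ∀ n, Measurable (X n)
  M01 : ∀ n ω, M n ω ∈ Set.Icc (0:ℝ) 1
  X01 : ∀ n ω, X n ω ∈ Set.Icc (0:ℝ) 1
  dyn : ∀ n ω, M (n+1) ω = M n ω + r n * (X n ω - M n ω)
  r0 : ∀ n, 0 ≤ r n
  r1 : ∀ n, r n < 1
  h1 : ∀ n g, BM (F n) g → ∫ ω, g ω * (X n ω - M n ω) ∂μ = 0
  h2 : ∀ n g, BM (F n) g → (∀ ω, 0 ≤ g ω) →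
    κ * ∫ ω, g ω * (M n ω * (1 - M n ω)) ∂μ ≤ ∫ ω, g ω * (X n ω - M n ω) ^ 2 ∂μ

namespace Proc
variable {Ω : Type*} [mΩ : MeasurableSpace Ω] {μ : Measure Ω} [IsProbabilityMeasure μ]
  {F : ℕ → MeasurableSpace Ω} {M X : ℕ → Ω → ℝ} {r : ℕ → ℝ} {κ : ℝ}

lemma shift (P : Proc μ F M X r κ) (n : ℕ) : Proc μ (fun k => F (n + k)) (fun k => M (n + k))
    (fun k => X (n + k)) (fun k => r (n + k)) κ where
  le k := P.le _
  mono a b h := P.mono (by omega)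
  Mm k := P.Mm _
  Xm k := P.Xm _
  M01 k := P.M01 _
  X01 k := P.X01 _
  dyn k := P.dyn _
  r0 k := P.r0 _
  r1 k := P.r1 _
  h1 k := P.h1 _
  h2 k := P.h2 _

lemma bM (P : Proc μ F M X r κ) (n : ℕ) : BM (F n) (M n) := BM.of01 (P.Mm n) (P.M01 n)
lemma bM' (P : Proc μ F M X r κ) (n : ℕ) : BM mΩ (M n) := (P.bM n).mono (P.le n)
lemma bX (P : Proc μ F M X r κ) (n : ℕ) : BM mΩ (X n) := BM.of01 (P.Xm n) (P.X01 n)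
lemma bY (P : Proc μ F M X r κ) (n : ℕ) : BM mΩ (fun ω => X n ω - M n ω) := (P.bX n).sub (P.bM' n)
lemma b0 (P : Proc μ F M X r κ) (n : ℕ) : BM (F n) (M 0) := (P.bM 0).mono (P.mono (Nat.zero_le n))
lemma bD (P : Proc μ F M X r κ) (n : ℕ) : BM (F n) (fun ω => M n ω - M 0 ω) :=
  (P.bM n).sub (P.b0 n)
lemma Y1 (P : Proc μ F M X r κ) (n : ℕ) (ω : Ω) : |X n ω - M n ω| ≤ 1 := by
  have a := P.M01 n ω
  have b := P.X01 n ω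
  rw [abs_le]; constructor <;> linarith [a.1, a.2, b.1, b.2]

/-- one step of `E[g M(1-M)]` -/
lemma stepV (P : Proc μ F M X r κ) (n : ℕ) {g : Ω → ℝ} (hg : BM (F n) g) (g0 : ∀ ω, 0 ≤ g ω) :
    (1 - r n ^ 2) * ∫ ω, g ω * (M n ω * (1 - M n ω)) ∂μ
      ≤ ∫ ω, g ω * (M (n+1) ω * (1 - M (n+1) ω)) ∂μ := by
  have hg' := hg.mono (P.le n)
  have bV : BM mΩ (fun ω => g ω * (M n ω * (1 - M n ω))) :=
    hg'.mul ((P.bM' n).mul ((BM.const 1).sub (P.bM' n)))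
  have bh : BM (F n) (fun ω => (r n - r n ^ 2) * (g ω * (1 - 2 * M n ω))) :=
    (BM.const _).mul (hg.mul ((BM.const 1).sub ((BM.const 2).mul (P.bM n))))
  have e := P.h1 n _ bh
  have e2 : ∫ ω, ((1 - r n ^ 2) * (g ω * (M n ω * (1 - M n ω)))
      + ((r n - r n ^ 2) * (g ω * (1 - 2 * M n ω))) * (X n ω - M n ω)) ∂μ
      = (1 - r n ^ 2) * ∫ ω, g ω * (M n ω * (1 - M n ω)) ∂μ := by
    rw [integral_add ((BM.const _).mul bV).int ((bh.mono (P.le n)).mul (P.bY n)).int, e,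
      integral_const_mul, add_zero]
  rw [← e2]
  apply integral_mono (((BM.const _).mul bV).add ((bh.mono (P.le n)).mul (P.bY n))).int
  · exact (hg'.mul ((P.bM' (n+1)).mul ((BM.const 1).sub (P.bM' (n+1))))).int
  intro ω
  simp only [P.dyn n ω]
  have hx := P.X01 n ω
  have key : 0 ≤ g ω * (r n ^ 2 * (X n ω - X n ω ^ 2)) := by
    have : 0 ≤ X n ω - X n ω ^ 2 := by nlinarith [hx.1, hx.2]
    have := g0 ω
    positivity
  nlinarith [key]

lemma lowV (P : Proc μ F M X r κ) {g : Ω → ℝ} (hg : BM (F 0) g) (g0 : ∀ ω, 0 ≤ g ω) (k : ℕ) :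
    (1 - ∑ i ∈ Finset.range k, r i ^ 2) * ∫ ω, g ω * (M 0 ω * (1 - M 0 ω)) ∂μ
      ≤ ∫ ω, g ω * (M k ω * (1 - M k ω)) ∂μ := by
  have v0 : 0 ≤ ∫ ω, g ω * (M 0 ω * (1 - M 0 ω)) ∂μ := integral_nonneg fun ω =>
    mul_nonneg (g0 ω) (mul_nonneg (P.M01 0 ω).1 (by linarith [(P.M01 0 ω).2]))
  induction k with
  | zero => simp
  | succ k ih =>
    refine le_trans ?_ (P.stepV k (hg.mono (P.mono (Nat.zero_le k))) g0)
    have hr : 0 ≤ 1 - r k ^ 2 := by nlinarith [P.r0 k, P.r1 k]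
    refine le_trans ?_ (mul_le_mul_of_nonneg_left ih hr)
    rw [Finset.sum_range_succ, ← mul_assoc]
    apply mul_le_mul_of_nonneg_right _ v0
    have : 0 ≤ ∑ i ∈ Finset.range k, r i ^ 2 := Finset.sum_nonneg fun i _ => sq_nonneg _
    nlinarith [mul_nonneg this (sq_nonneg (r k))]

lemma posV (P : Proc μ F M X r κ) (h : 0 < ∫ ω, M 0 ω * (1 - M 0 ω) ∂μ) (k : ℕ) :
    0 < ∫ ω, M k ω * (1 - M k ω) ∂μ := by
  induction k with
  | zero => exact h
  | succ k ih =>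
    have := P.stepV k (BM.const 1) (fun _ => zero_le_one)
    simp only [one_mul] at this
    refine lt_of_lt_of_le (mul_pos ?_ ih) this
    nlinarith [P.r0 k, P.r1 k]

lemma zeroD (P : Proc μ F M X r κ) {g : Ω → ℝ} (hg : BM (F 0) g) (k : ℕ) :
    ∫ ω, g ω * (M k ω - M 0 ω) ∂μ = 0 := by
  induction k with
  | zero => simp
  | succ k ih =>
    have hgk := hg.mono (P.mono (Nat.zero_le k))
    have hg' := hg.mono (P.le 0)
    have e := P.h1 k _ ((BM.const (r k)).mul hgk)
    have : ∀ ω, g ω * (M (k+1) ω - M 0 ω) = g ω * (M k ω - M 0 ω)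
        + (r k * g ω) * (X k ω - M k ω) := fun ω => by rw [P.dyn]; ring
    simp only [this]
    rw [integral_add (hg'.mul ((P.bD k).mono (P.le k))).int
      (((BM.const _).mul hg').mul (P.bY k)).int, ih, e, add_zero]

lemma stepD2 (P : Proc μ F M X r κ) {g : Ω → ℝ} (hg : BM (F 0) g) (k : ℕ) :
    ∫ ω, g ω * (M (k+1) ω - M 0 ω) ^ 2 ∂μ = ∫ ω, g ω * (M k ω - M 0 ω) ^ 2 ∂μ
      + r k ^ 2 * ∫ ω, g ω * (X k ω - M k ω) ^ 2 ∂μ := by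
  have hgk := hg.mono (P.mono (Nat.zero_le k))
  have hg' := hg.mono (P.le 0)
  have bD' := (P.bD k).mono (P.le k)
  have bh := (BM.const (2 * r k)).mul (hgk.mul (P.bD k))
  have e := P.h1 k _ bh
  have : ∀ ω, g ω * (M (k+1) ω - M 0 ω) ^ 2 = g ω * (M k ω - M 0 ω) ^ 2
        + (2 * r k * (g ω * (M k ω - M 0 ω))) * (X k ω - M k ω)
        + r k ^ 2 * (g ω * (X k ω - M k ω) ^ 2) := fun ω => by rw [P.dyn]; ring
  simp only [this]
  have i1 := hg'.mul (bD'.pow 2)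
  have i2 := (bh.mono (P.le k)).mul (P.bY k)
  have i3 := (BM.const (m := mΩ) (r k ^ 2)).mul (hg'.mul ((P.bY k).pow 2))
  rw [integral_add (i1.add i2).int i3.int, integral_add i1.int i2.int, e, integral_const_mul,
    add_zero]

lemma lowD2 (P : Proc μ F M X r κ) (hκ : 0 ≤ κ)
    (hS : ∀ k, ∑ i ∈ Finset.range k, r i ^ 2 ≤ 1 / 2) {g : Ω → ℝ} (hg : BM (F 0) g)
    (g0 : ∀ ω, 0 ≤ g ω) (k : ℕ) :
    κ / 2 * (∑ i ∈ Finset.range k, r i ^ 2) * ∫ ω, g ω * (M 0 ω * (1 - M 0 ω)) ∂μ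
      ≤ ∫ ω, g ω * (M k ω - M 0 ω) ^ 2 ∂μ := by
  have v0 : 0 ≤ ∫ ω, g ω * (M 0 ω * (1 - M 0 ω)) ∂μ := integral_nonneg fun ω =>
    mul_nonneg (g0 ω) (mul_nonneg (P.M01 0 ω).1 (by linarith [(P.M01 0 ω).2]))
  induction k with
  | zero => simp
  | succ k ih =>
    rw [P.stepD2 hg, Finset.sum_range_succ]
    have a := P.h2 k g (hg.mono (P.mono (Nat.zero_le k))) g0
    have b := P.lowV hg g0 k
    have c : 1 / 2 * ∫ ω, g ω * (M 0 ω * (1 - M 0 ω)) ∂μ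
      ≤ ∫ ω, g ω * (M k ω * (1 - M k ω)) ∂μ :=
      le_trans (mul_le_mul_of_nonneg_right (by linarith [hS k]) v0) b
    have d := mul_le_mul_of_nonneg_left (le_trans (mul_le_mul_of_nonneg_left c hκ) a)
      (sq_nonneg (r k))
    nlinarith

lemma upD2 (P : Proc μ F M X r κ) {g : Ω → ℝ} (hg : BM (F 0) g)
    (g0 : ∀ ω, 0 ≤ g ω) (k : ℕ) :
    ∫ ω, g ω * (M k ω - M 0 ω) ^ 2 ∂μ ≤ (∑ i ∈ Finset.range k, r i ^ 2) * ∫ ω, g ω ∂μ := by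
  have hg' := hg.mono (P.le 0)
  induction k with
  | zero => simp
  | succ k ih =>
    rw [P.stepD2 hg, Finset.sum_range_succ, add_mul]
    refine add_le_add ih (mul_le_mul_of_nonneg_left ?_ (sq_nonneg _))
    apply integral_mono (hg'.mul ((P.bY k).pow 2)).int hg'.int
    intro ω
    have := (sq_le_one_iff_abs_le_one _).2 (P.Y1 k ω)
    exact mul_le_of_le_one_right (g0 ω) this

lemma upD4 (P : Proc μ F M X r κ) {g : Ω → ℝ} (hg : BM (F 0) g)
    (g0 : ∀ ω, 0 ≤ g ω) (k : ℕ) :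
    ∫ ω, g ω * (M k ω - M 0 ω) ^ 4 ∂μ
      ≤ 4 * (∑ i ∈ Finset.range k, r i ^ 2) ^ 2 * ∫ ω, g ω ∂μ := by
  have hg' := hg.mono (P.le 0)
  induction k with
  | zero => simp
  | succ k ih =>
    have hgk := hg.mono (P.mono (Nat.zero_le k))
    have bD' := (P.bD k).mono (P.le k)
    have bh := (BM.const (4 * r k)).mul (hgk.mul ((P.bD k).pow 3))
    have e := P.h1 k _ bh
    have i1 := hg'.mul (bD'.pow 4)
    have i2 := (bh.mono (P.le k)).mul (P.bY k)
    have i3 := (BM.const (m := mΩ) (8 * r k ^ 2)).mul (hg'.mul (bD'.pow 2))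
    have i4 := (BM.const (m := mΩ) (3 * r k ^ 4)).mul hg'
    have le : ∫ ω, g ω * (M (k+1) ω - M 0 ω) ^ 4 ∂μ ≤ ∫ ω, (g ω * (M k ω - M 0 ω) ^ 4
        + (4 * r k * (g ω * (M k ω - M 0 ω) ^ 3)) * (X k ω - M k ω)
        + 8 * r k ^ 2 * (g ω * (M k ω - M 0 ω) ^ 2) + 3 * r k ^ 4 * g ω) ∂μ := by
      apply integral_mono (hg'.mul (((P.bD (k+1)).mono (P.le _)).pow 4)).int
        (((i1.add i2).add i3).add i4).int
      intro ω
      simp only [P.dyn k ω]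
      have y1 := P.Y1 k ω
      generalize X k ω - M k ω = y at *
      have : M k ω + r k * y - M 0 ω = (M k ω - M 0 ω) + r k * y := by ring
      rw [this]
      generalize M k ω - M 0 ω = d
      have y2 : y ^ 2 ≤ 1 := (sq_le_one_iff_abs_le_one _).2 y1
      have q : (d + r k * y) ^ 4 ≤ d ^ 4 + 4 * r k * d ^ 3 * y + 8 * r k ^ 2 * d ^ 2
          + 3 * r k ^ 4 := by
        have a1 : 0 ≤ (d * r k) ^ 2 * (1 - y ^ 2) := mul_nonneg (sq_nonneg _) (by linarith)
        have a2 : 0 ≤ (r k ^ 2) ^ 2 * (1 - y ^ 2) := mul_nonneg (sq_nonneg _) (by linarith)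
        have a3 : 0 ≤ (r k ^ 2) ^ 2 * (1 - y ^ 2) * y ^ 2 := mul_nonneg a2 (sq_nonneg _)
        have a4 : 0 ≤ 2 * y ^ 2 * (r k * d - r k ^ 2 * y) ^ 2 := by positivity
        nlinarith
      have := mul_le_mul_of_nonneg_left q (g0 ω)
      nlinarith
    rw [integral_add ((i1.add i2).add i3).int i4.int, integral_add (i1.add i2).int i3.int,
      integral_add i1.int i2.int, e, integral_const_mul, integral_const_mul, add_zero] at le
    have u := mul_le_mul_of_nonneg_left (P.upD2 hg g0 k) (by positivity : 0 ≤ 8 * r k ^ 2)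
    have v0 : 0 ≤ ∫ ω, g ω ∂μ := integral_nonneg g0
    have v1 : 0 ≤ r k ^ 4 * ∫ ω, g ω ∂μ := by positivity
    rw [Finset.sum_range_succ]
    nlinarith
end Proc
namespace Proc
variable {Ω : Type*} [mΩ : MeasurableSpace Ω] {μ : Measure Ω} [IsProbabilityMeasure μ]
  {F : ℕ → MeasurableSpace Ω} {M X : ℕ → Ω → ℝ} {r : ℕ → ℝ} {κ : ℝ}

lemma core (P : Proc μ F M X r κ) (hκ : 0 < κ) {S : ℝ} (hS : HasSum (fun i => r i ^ 2) S)
    (S0 : 0 < S) (S2 : S ≤ 1 / 2) {η : ℝ} (hη : 0 < η) {g : Ω → ℝ} (hg : BM (F 0) g)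
    (g0 : ∀ ω, 0 ≤ g ω) (hsupp : ∀ ω, g ω ≠ 0 → η ≤ M 0 ω * (1 - M 0 ω)) (z : ℝ)
    (Zl : Ω → ℝ) (hZ : Measurable Zl)
    (hlim : ∀ᵐ ω ∂μ, Tendsto (fun k => M k ω) atTop (nhds (Zl ω))) :
    (min 1 (κ * η / 2)) ^ 2 / 32 * ∫ ω, g ω ∂μ
      ≤ ∫ ω, g ω * ({ω | Zl ω ≠ z}.indicator (fun _ => 1) ω) ∂μ := by
  set c := min 1 (κ * η / 2) with hc
  have c0 : 0 < c := lt_min one_pos (by positivity)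
  have c1 : c ≤ 1 := min_le_left _ _
  have c2 : c ≤ κ * η / 2 := min_le_right _ _
  have hs : ∀ k, ∑ i ∈ Finset.range k, r i ^ 2 ≤ S := fun k =>
    sum_le_hasSum _ (fun i _ => sq_nonneg _) hS
  have hs0 : ∀ k, 0 ≤ ∑ i ∈ Finset.range k, r i ^ 2 := fun k =>
    Finset.sum_nonneg fun i _ => sq_nonneg _
  have hg' := hg.mono (P.le 0)
  have bM0 := P.bM' 0
  -- the weight
  set a : Ω → ℝ := fun ω => M 0 ω - z with ha
  have ba : BM (F 0) a := (P.bM 0).sub (BM.const z)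
  have ba' := ba.mono (P.le 0)
  set t : Ω → ℝ := fun ω => (c / 32) / (a ω ^ 2 + S) with ht
  have t0 : ∀ ω, 0 ≤ t ω := fun ω => by simp only [ht]; positivity
  have bt : BM (F 0) t := by
    refine ⟨measurable_const.div ((ba.pow 2).1.add measurable_const), (c / 32) / S, fun ω => ?_⟩
    rw [abs_of_nonneg (t0 ω)]
    simp only [ht]
    gcongr
    nlinarith [sq_nonneg (a ω)]
  have te : ∀ ω, t ω * (a ω ^ 2 + S) = c / 32 := fun ω => by
    simp only [ht]; field_simp
  have bt' := bt.mono (P.le 0)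
  have bh := hg.mul bt
  have bh' := hg'.mul bt'
  have h0 : ∀ ω, 0 ≤ g ω * t ω := fun ω => mul_nonneg (g0 ω) (t0 ω)
  have bh2 := hg.mul (bt.pow 2)
  have bh2' := hg'.mul (bt'.pow 2)
  have h20 : ∀ ω, 0 ≤ g ω * t ω ^ 2 := fun ω => mul_nonneg (g0 ω) (sq_nonneg _)
  have bD : ∀ k, BM mΩ (fun ω => M k ω - M 0 ω) := fun k => (P.bD k).mono (P.le k)
  have bW : ∀ k, BM mΩ (fun ω => M k ω - z) := fun k => (P.bM' k).sub (BM.const z)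
  -- lower bound
  have low : ∀ k, ∫ ω, g ω * t ω * a ω ^ 2 ∂μ
      + κ * η / 2 * (∑ i ∈ Finset.range k, r i ^ 2) * ∫ ω, g ω * t ω ∂μ
      ≤ ∫ ω, g ω * t ω * (M k ω - z) ^ 2 ∂μ := by
    intro k
    have e : ∀ ω, g ω * t ω * (M k ω - z) ^ 2 = g ω * t ω * a ω ^ 2
        + (2 * (g ω * t ω * a ω)) * (M k ω - M 0 ω) + g ω * t ω * (M k ω - M 0 ω) ^ 2 := fun ω => by
      simp only [ha]; ring
    simp only [e]
    have bx := (BM.const 2).mul (bh.mul ba)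
    have i1 := bh'.mul (ba'.pow 2)
    have i2 := (bx.mono (P.le 0)).mul (bD k)
    have i3 := bh'.mul ((bD k).pow 2)
    rw [integral_add (i1.add i2).int i3.int, integral_add i1.int i2.int, P.zeroD bx k, add_zero]
    refine add_le_add le_rfl ?_
    refine le_trans ?_ (P.lowD2 hκ.le (fun k => (hs k).trans S2) bh h0 k)
    have : η * ∫ ω, g ω * t ω ∂μ ≤ ∫ ω, g ω * t ω * (M 0 ω * (1 - M 0 ω)) ∂μ := by
      rw [← integral_const_mul]
      apply integral_mono ((BM.const _).mul bh').int
        (bh'.mul (bM0.mul ((BM.const 1).sub bM0))).int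
      intro ω
      by_cases hz : g ω = 0
      · simp [hz]
      · have := mul_le_mul_of_nonneg_left (hsupp ω hz) (h0 ω)
        simp only
        linarith
    have := mul_le_mul_of_nonneg_left this
      (mul_nonneg (by positivity : 0 ≤ κ / 2) (hs0 k))
    linarith
  -- upper bound
  have up : ∀ k, ∫ ω, g ω * t ω ^ 2 * (M k ω - z) ^ 4 ∂μ
      ≤ 8 * ∫ ω, g ω * t ω ^ 2 * a ω ^ 4 ∂μ + 32 * S ^ 2 * ∫ ω, g ω * t ω ^ 2 ∂μ := by
    intro k
    have i1 := (BM.const 8).mul (bh2'.mul (ba'.pow 4))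
    have i2 := (BM.const 8).mul (bh2'.mul ((bD k).pow 4))
    have : ∫ ω, g ω * t ω ^ 2 * (M k ω - z) ^ 4 ∂μ ≤ ∫ ω, (8 * (g ω * t ω ^ 2 * a ω ^ 4)
        + 8 * (g ω * t ω ^ 2 * (M k ω - M 0 ω) ^ 4)) ∂μ := by
      apply integral_mono (bh2'.mul ((bW k).pow 4)).int (i1.add i2).int
      intro ω
      have : M k ω - z = a ω + (M k ω - M 0 ω) := by simp only [ha]; ring
      simp only [this]
      generalize M k ω - M 0 ω = d
      have q : (a ω + d) ^ 4 ≤ 8 * a ω ^ 4 + 8 * d ^ 4 := by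
        have q1 : (a ω + d) ^ 2 ≤ 2 * (a ω ^ 2 + d ^ 2) := by nlinarith [sq_nonneg (a ω - d)]
        have q2 : ((a ω + d) ^ 2) ^ 2 ≤ (2 * (a ω ^ 2 + d ^ 2)) ^ 2 :=
          pow_le_pow_left₀ (sq_nonneg _) q1 2
        nlinarith [sq_nonneg (a ω ^ 2 - d ^ 2)]
      have := mul_le_mul_of_nonneg_left q (h20 ω)
      linarith
    rw [integral_add i1.int i2.int, integral_const_mul, integral_const_mul] at this
    have u := P.upD4 bh2 h20 k
    have v0 : 0 ≤ ∫ ω, g ω * t ω ^ 2 ∂μ := integral_nonneg h20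
    have : (∑ i ∈ Finset.range k, r i ^ 2) ^ 2 * ∫ ω, g ω * t ω ^ 2 ∂μ
      ≤ S ^ 2 * ∫ ω, g ω * t ω ^ 2 ∂μ :=
      mul_le_mul_of_nonneg_right (pow_le_pow_left₀ (hs0 k) (hs k) 2) v0
    linarith
  -- limit
  obtain ⟨C1, hC1⟩ := bh'.2
  obtain ⟨C2, hC2⟩ := bh2'.2
  have Zb : ∀ᵐ ω ∂μ, Zl ω ∈ Set.Icc (0:ℝ) 1 := by
    filter_upwards [hlim] with ω h
    exact isClosed_Icc.mem_of_tendsto h (Eventually.of_forall fun k => P.M01 k ω)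
  have bdd : ∀ ω, ∀ x ∈ Set.Icc (0:ℝ) 1,
      ‖2 * (g ω * t ω * (x - z) ^ 2) - g ω * t ω ^ 2 * (x - z) ^ 4‖
        ≤ 2 * (C1 * (1 + |z|) ^ 2) + C2 * (1 + |z|) ^ 4 := by
    intro ω x hx
    have hxz : |x - z| ≤ 1 + |z| := (abs_sub _ _).trans
      (add_le_add (by rw [abs_of_nonneg hx.1]; exact hx.2) le_rfl)
    rw [Real.norm_eq_abs]
    refine (abs_sub _ _).trans (add_le_add ?_ ?_)
    · rw [abs_mul, abs_mul, abs_pow, abs_two]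
      have := hC1 ω
      have : 0 ≤ C1 := (abs_nonneg _).trans this
      gcongr
    · rw [abs_mul, abs_pow]
      have := hC2 ω
      have : 0 ≤ C2 := (abs_nonneg _).trans this
      gcongr
  have bI : ∀ k, BM mΩ (fun ω => 2 * (g ω * t ω * (M k ω - z) ^ 2)
      - g ω * t ω ^ 2 * (M k ω - z) ^ 4) := fun k =>
    ((BM.const 2).mul (bh'.mul ((bW k).pow 2))).sub (bh2'.mul ((bW k).pow 4))
  have lim := tendsto_integral_of_dominated_convergence (μ := μ)
    (F := fun k ω => 2 * (g ω * t ω * (M k ω - z) ^ 2) - g ω * t ω ^ 2 * (M k ω - z) ^ 4)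
    (f := fun ω => 2 * (g ω * t ω * (Zl ω - z) ^ 2) - g ω * t ω ^ 2 * (Zl ω - z) ^ 4)
    (fun _ => 2 * (C1 * (1 + |z|) ^ 2) + C2 * (1 + |z|) ^ 4)
    (fun k => (bI k).1.aestronglyMeasurable) (integrable_const _)
    (fun k => ae_of_all _ fun ω => bdd ω _ (P.M01 k ω))
    (by
      filter_upwards [hlim] with ω h
      have := h.sub_const z
      exact (((this.pow 2).const_mul _).const_mul 2).sub ((this.pow 4).const_mul _))
  have lowlim : Tendsto (fun k => 2 * (∫ ω, g ω * t ω * a ω ^ 2 ∂μ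
      + κ * η / 2 * (∑ i ∈ Finset.range k, r i ^ 2) * ∫ ω, g ω * t ω ∂μ)
      - (8 * ∫ ω, g ω * t ω ^ 2 * a ω ^ 4 ∂μ + 32 * S ^ 2 * ∫ ω, g ω * t ω ^ 2 ∂μ)) atTop
      (nhds (2 * (∫ ω, g ω * t ω * a ω ^ 2 ∂μ + κ * η / 2 * S * ∫ ω, g ω * t ω ∂μ)
      - (8 * ∫ ω, g ω * t ω ^ 2 * a ω ^ 4 ∂μ + 32 * S ^ 2 * ∫ ω, g ω * t ω ^ 2 ∂μ))) :=
    ((((hS.tendsto_sum_nat.const_mul _).mul_const _).const_add _).const_mul 2).sub_const _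
  have main := le_of_tendsto_of_tendsto' lowlim lim (fun k => by
    rw [integral_sub ((BM.const 2).mul (bh'.mul ((bW k).pow 2))).int
      (bh2'.mul ((bW k).pow 4)).int, integral_const_mul]
    linarith [low k, up k])
  -- compare
  have j1 := bh'.mul (ba'.pow 2)
  have j2 := (BM.const (m := mΩ) (κ * η / 2 * S)).mul bh'
  have j3 := (BM.const 8).mul (bh2'.mul (ba'.pow 4))
  have j4 := (BM.const (m := mΩ) (32 * S ^ 2)).mul bh2'
  have first : c ^ 2 / 32 * ∫ ω, g ω ∂μ ≤ 2 * (∫ ω, g ω * t ω * a ω ^ 2 ∂μ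
      + κ * η / 2 * S * ∫ ω, g ω * t ω ∂μ)
      - (8 * ∫ ω, g ω * t ω ^ 2 * a ω ^ 4 ∂μ + 32 * S ^ 2 * ∫ ω, g ω * t ω ^ 2 ∂μ) := by
    rw [← integral_const_mul, ← integral_const_mul, ← integral_const_mul, ← integral_const_mul,
      ← integral_add j1.int j2.int, ← integral_add j3.int j4.int, ← integral_const_mul,
      ← integral_sub ((BM.const 2).mul (j1.add j2)).int (j3.add j4).int]
    apply integral_mono ((BM.const _).mul hg').int
      (((BM.const 2).mul (j1.add j2)).sub (j3.add j4)).int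
    intro ω
    have e := te ω
    have x1 : c * (t ω * (a ω ^ 2 + S)) ≤ t ω * (a ω ^ 2 + κ * η / 2 * S) := by
      have y1 : c * a ω ^ 2 ≤ a ω ^ 2 := mul_le_of_le_one_left (sq_nonneg _) c1
      have y2 : c * S ≤ κ * η / 2 * S := mul_le_mul_of_nonneg_right c2 S0.le
      have := mul_le_mul_of_nonneg_left (add_le_add y1 y2) (t0 ω)
      linarith
    have x2 : 8 * t ω ^ 2 * a ω ^ 4 + 32 * S ^ 2 * t ω ^ 2 ≤ 32 * (t ω * (a ω ^ 2 + S)) ^ 2 := by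
      have : 0 ≤ t ω ^ 2 * (24 * a ω ^ 4 + 64 * (a ω ^ 2 * S)) := by positivity
      nlinarith
    rw [e] at x1 x2
    have := mul_le_mul_of_nonneg_left (sub_le_sub (mul_le_mul_of_nonneg_left x1 zero_le_two) x2)
      (g0 ω)
    simp only
    linarith
  refine first.trans (main.trans ?_)
  have mE : MeasurableSet {ω | Zl ω ≠ z} := (hZ (measurableSet_singleton z)).compl
  apply integral_mono_ae
  · refine Integrable.of_bound (Measurable.aestronglyMeasurable ?_) _
      (by filter_upwards [Zb] with ω h using bdd ω _ h)
    exact ((bh'.1.mul ((hZ.sub_const z).pow_const 2)).const_mul 2).sub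
      (bh2'.1.mul ((hZ.sub_const z).pow_const 4))
  · refine (hg'.mul (BM.of01 (measurable_const.indicator mE) fun ω => ?_)).int
    by_cases h : Zl ω = z <;> simp [h]
  · refine ae_of_all _ fun ω => ?_
    by_cases h : Zl ω = z
    · simp [h]
    · have : {ω | Zl ω ≠ z}.indicator (fun _ => (1:ℝ)) ω = 1 := Set.indicator_of_mem h _
      simp only [this]
      nlinarith [mul_nonneg (g0 ω) (sq_nonneg (t ω * (Zl ω - z) ^ 2 - 1))]

lemma part1 (P : Proc μ F M X r κ) (hS : Summable (fun i => r i ^ 2))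
    (h : 0 < ∫ ω, M 0 ω * (1 - M 0 ω) ∂μ) (Zl : Ω → ℝ) (hZ : Measurable Zl)
    (hlim : ∀ᵐ ω ∂μ, Tendsto (fun k => M k ω) atTop (nhds (Zl ω))) :
    μ {ω | Zl ω = 0 ∨ Zl ω = 1} < 1 := by
  refine lt_of_le_of_ne prob_le_one fun h1 => ?_
  have mE : MeasurableSet {ω | Zl ω = 0 ∨ Zl ω = 1} :=
    (hZ (measurableSet_singleton 0)).union (hZ (measurableSet_singleton 1))
  have hae : ∀ᵐ ω ∂μ, Zl ω = 0 ∨ Zl ω = 1 := (prob_compl_eq_zero_iff mE).2 h1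
  have t := tendsto_sum_nat_add (fun i => r i ^ 2)
  obtain ⟨n, hn⟩ := (t.eventually (gt_mem_nhds (by norm_num : (0:ℝ) < 1 / 2))).exists
  have Q := P.shift n
  have pos := P.posV h n
  have low : ∀ k, 1 / 2 * ∫ ω, M n ω * (1 - M n ω) ∂μ
      ≤ ∫ ω, M (n + k) ω * (1 - M (n + k) ω) ∂μ := by
    intro k
    have := Q.lowV (BM.const 1) (fun _ => zero_le_one) k
    simp only [one_mul, add_zero] at this
    refine le_trans (mul_le_mul_of_nonneg_right ?_ pos.le) this
    have s1 : ∑ i ∈ Finset.range k, r (n + i) ^ 2 ≤ ∑' i, r (n + i) ^ 2 :=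
      Summable.sum_le_tsum _ (fun i _ => sq_nonneg _)
        (by simpa [add_comm] using (summable_nat_add_iff n).2 hS)
    simp only [add_comm _ n] at hn
    linarith
  have lim := tendsto_integral_of_dominated_convergence (μ := μ)
    (F := fun k ω => M (n + k) ω * (1 - M (n + k) ω)) (f := fun ω => Zl ω * (1 - Zl ω))
    (fun _ => 1)
    (fun k => ((P.bM' _).mul ((BM.const 1).sub (P.bM' _))).1.aestronglyMeasurable)
    (integrable_const _)
    (fun k => ae_of_all _ fun ω => by
      have := P.M01 (n + k) ω
      rw [Real.norm_eq_abs, abs_le]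
      constructor <;> nlinarith [this.1, this.2])
    (by
      filter_upwards [hlim] with ω h
      have h' : Tendsto (fun k => M (n + k) ω) atTop (nhds (Zl ω)) := by
        simpa [add_comm] using (tendsto_add_atTop_iff_nat n).2 h
      exact h'.mul (h'.const_sub 1))
  have := ge_of_tendsto' lim low
  have z : ∫ ω, Zl ω * (1 - Zl ω) ∂μ = 0 := by
    rw [← integral_zero Ω ℝ (μ := μ)]
    apply integral_congr_ae
    filter_upwards [hae] with ω h
    rcases h with h | h <;> simp [h]
  linarith

lemma part2 (P : Proc μ F M X r κ) (hκ : 0 < κ) (hS : Summable (fun i => r i ^ 2))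
    (hpos : ∀ n, ∃ k, 0 < r (n + k)) (Zl : Ω → ℝ) (hZ : Measurable Zl)
    (hlim : ∀ᵐ ω ∂μ, Tendsto (fun k => M k ω) atTop (nhds (Zl ω)))
    (z : ℝ) (hz : z ∈ Set.Ioo (0:ℝ) 1) : μ {ω | Zl ω = z} = 0 := by
  have zz : 0 < z * (1 - z) := mul_pos hz.1 (by linarith [hz.2])
  set η := z * (1 - z) / 2 with hη
  have η0 : 0 < η := by positivity
  set δ := (min 1 (κ * η / 2)) ^ 2 / 32 with hδ
  have δ0 : 0 < δ := by
    have : 0 < min 1 (κ * η / 2) := lt_min one_pos (by positivity)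
    positivity
  let FF : Filtration ℕ mΩ := ⟨F, P.mono, P.le⟩
  set E : Set Ω := {ω | Tendsto (fun k => M k ω) atTop (nhds z)} with hE
  have mE : MeasurableSet[⨆ n, F n] E := by
    exact BM.mtend (fun k => (P.Mm k).mono (le_iSup F k) le_rfl) z
  have mE' : MeasurableSet E := (iSup_le P.le) _ mE
  set ind : Ω → ℝ := E.indicator (fun _ => 1) with hind
  have bind : BM mΩ ind := BM.of01 (measurable_const.indicator mE') fun ω => by
    by_cases h : ω ∈ E <;> simp [ind, h]
  have ief : ∀ᵐ ω ∂μ, ind ω + {ω | Zl ω ≠ z}.indicator (fun _ => (1:ℝ)) ω = 1 := by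
    filter_upwards [hlim] with ω h
    by_cases e : Zl ω = z
    · have : ω ∈ E := by rw [hE, ← e]; exact h
      simp [ind, this, e]
    · have : ω ∉ E := fun h' => e (tendsto_nhds_unique h h')
      simp [ind, this, e]
  have levy := tendsto_ae_condExp (μ := μ) (ℱ := FF) ind
  have efix : μ[ind | ⨆ n, FF n] = ind :=
    condExp_of_stronglyMeasurable (iSup_le P.le)
      (measurable_const.indicator mE : Measurable[⨆ n, F n] ind).stronglyMeasurable bind.int
  rw [efix] at levy
  have mN : MeasurableSet {ω | Zl ω ≠ z} := (hZ (measurableSet_singleton z)).compl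
  have t := tendsto_sum_nat_add (fun i => r i ^ 2)
  have ev := t.eventually (gt_mem_nhds (by norm_num : (0:ℝ) < 1 / 2))
  let B : ℕ → Set Ω := fun n => {ω | η ≤ M n ω * (1 - M n ω)} ∩ {ω | 1 - δ < (μ[ind | F n]) ω}
  have bad : ∀ᶠ n in atTop, ∀ᵐ ω ∂μ, ω ∉ B n := by
    filter_upwards [ev] with n hn
    simp only [add_comm _ n] at hn
    have Q := P.shift n
    have sm : Summable (fun i => r (n + i) ^ 2) := by
      simpa [add_comm] using (summable_nat_add_iff n).2 hS
    obtain ⟨k, hk⟩ := hpos n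
    have S0 : 0 < ∑' i, r (n + i) ^ 2 := sm.tsum_pos (fun i => sq_nonneg _) k (by positivity)
    have mB : MeasurableSet[F n] (B n) := by
      refine MeasurableSet.inter ?_ ?_
      · exact BM.mle ((P.bM n).mul ((BM.const 1).sub (P.bM n))).1 _
      · exact BM.mlt stronglyMeasurable_condExp.measurable _
    have mB' := P.le n _ mB
    have bg : BM (F n) ((B n).indicator (fun _ => (1:ℝ))) :=
      BM.of01 (measurable_const.indicator mB) fun ω => by
        by_cases h : ω ∈ B n <;> simp [h]
    have hl : ∀ᵐ ω ∂μ, Tendsto (fun k => M (n + k) ω) atTop (nhds (Zl ω)) := by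
      filter_upwards [hlim] with ω h
      simpa [add_comm] using (tendsto_add_atTop_iff_nat n).2 h
    have key := Q.core hκ sm.hasSum S0 hn.le η0 (g := (B n).indicator (fun _ => (1:ℝ))) bg
      (fun ω => Set.indicator_nonneg (fun _ _ => zero_le_one) ω)
      (fun ω h => (Set.mem_of_indicator_ne_zero h).1) z Zl hZ hl
    have bg' := bg.mono (P.le n)
    have bN : BM mΩ ({ω | Zl ω ≠ z}.indicator (fun _ => (1:ℝ))) :=
      BM.of01 (measurable_const.indicator mN) fun ω => by
        by_cases h : Zl ω = z <;> simp [h]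
    have sum1 : ∫ ω, (B n).indicator (fun _ => (1:ℝ)) ω * ind ω ∂μ
        + ∫ ω, (B n).indicator (fun _ => (1:ℝ)) ω * {ω | Zl ω ≠ z}.indicator (fun _ => (1:ℝ)) ω ∂μ
        = ∫ ω, (B n).indicator (fun _ => (1:ℝ)) ω ∂μ := by
      rw [← integral_add (bg'.mul bind).int (bg'.mul bN).int]
      apply integral_congr_ae
      filter_upwards [ief] with ω h
      rw [← mul_add, h, mul_one]
    have ci : ∫ ω, (B n).indicator (fun _ => (1:ℝ)) ω * ind ω ∂μ
        = ∫ ω, (B n).indicator (fun _ => (1:ℝ)) ω * (μ[ind | F n]) ω ∂μ :=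
      BM.condInt (P.le n) bg bind (Eventually.of_forall fun _ => rfl)
    have ig : Integrable (fun ω => (B n).indicator (fun _ => (1:ℝ)) ω * (μ[ind | F n]) ω) μ := by
      have := (integrable_condExp (m := F n) (μ := μ) (f := ind)).indicator mB'
      refine this.congr (Eventually.of_forall fun ω => ?_)
      by_cases h : ω ∈ B n <;> simp [h]
    have ig2 : Integrable (fun ω => (1 - δ) * (B n).indicator (fun _ => (1:ℝ)) ω) μ :=
      ((BM.const _).mul bg').int
    have nn : 0 ≤ fun ω => (B n).indicator (fun _ => (1:ℝ)) ω * (μ[ind | F n]) ω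
        - (1 - δ) * (B n).indicator (fun _ => (1:ℝ)) ω := by
      intro ω
      by_cases h : ω ∈ B n
      · have := h.2
        simp only [Set.mem_ofPred_eq] at this
        simp [h]; linarith
      · simp [h]
    have z0 : ∫ ω, ((B n).indicator (fun _ => (1:ℝ)) ω * (μ[ind | F n]) ω
        - (1 - δ) * (B n).indicator (fun _ => (1:ℝ)) ω) ∂μ = 0 := by
      apply le_antisymm _ (integral_nonneg nn)
      rw [integral_sub ig ig2, integral_const_mul, ← ci]
      rw [← hδ] at key
      linarith
    have := (integral_eq_zero_iff_of_nonneg nn (ig.sub ig2)).1 z0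
    filter_upwards [this] with ω h hB
    have h2 := hB.2
    simp only [Set.mem_ofPred_eq] at h2
    simp [hB] at h
    linarith
  obtain ⟨n0, hn0⟩ := eventually_atTop.1 bad
  have bad' : ∀ᵐ ω ∂μ, ∀ n, n0 ≤ n → ω ∉ B n := by
    rw [ae_all_iff]; intro n
    by_cases h : n0 ≤ n
    · filter_upwards [hn0 n h] with ω hω _ using hω
    · exact ae_of_all _ fun ω h' => absurd h' h
  have : ∀ᵐ ω ∂μ, Zl ω ≠ z := by
    filter_upwards [bad', levy, hlim] with ω hb hl hm e
    rw [e] at hm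
    have hω : ω ∈ E := hm
    have : ind ω = 1 := Set.indicator_of_mem hω _
    rw [this] at hl
    have e1 := hl.eventually (lt_mem_nhds (by linarith : 1 - δ < 1))
    have e2 := (hm.mul (hm.const_sub 1)).eventually (lt_mem_nhds (by linarith : η < z * (1 - z)))
    obtain ⟨n, a, b, c⟩ := (e1.and (e2.and (eventually_ge_atTop n0))).exists
    exact hb n c ⟨b.le, a⟩
  simpa [ae_iff] using this
end Proc
lemma rate_summable {r : ℕ → ℝ} {c γ : ℝ} (hγ : 1/2 < γ)
    (hlim : Tendsto (fun n : ℕ => (n : ℝ) ^ γ * r n) atTop (nhds c)) :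
    Summable (fun i => r i ^ 2) := by
  have hs : Summable (fun n : ℕ => (|c| + 1) ^ 2 * ((n:ℝ) ^ (2 * γ))⁻¹) :=
    (Real.summable_nat_rpow_inv.2 (by linarith)).mul_left _
  refine Summable.of_norm_bounded_eventually_nat hs ?_
  have e := hlim.abs.eventually (gt_mem_nhds (by linarith : |c| < |c| + 1))
  filter_upwards [e, eventually_gt_atTop 0] with n hn n0
  have np : (0:ℝ) < n := by exact_mod_cast n0
  have hp : 0 < (n:ℝ) ^ γ := Real.rpow_pos_of_pos np _
  have e2 : (n:ℝ) ^ (2 * γ) = ((n:ℝ) ^ γ) ^ 2 := by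
    rw [mul_comm, Real.rpow_mul np.le]; norm_num
  rw [Real.norm_of_nonneg (sq_nonneg _), e2, ← div_eq_mul_inv, le_div_iff₀ (by positivity),
    ← mul_pow, mul_comm]
  exact sq_le_sq' (by linarith [neg_abs_le ((n:ℝ) ^ γ * r n)])
    ((le_abs_self _).trans hn.le)

lemma rate_pos {r : ℕ → ℝ} {c γ : ℝ} (hc : 0 < c)
    (hlim : Tendsto (fun n : ℕ => (n : ℝ) ^ γ * r n) atTop (nhds c)) (n : ℕ) :
    ∃ k, 0 < r (n + k) := by
  obtain ⟨m, hm, hn⟩ := ((hlim.eventually (lt_mem_nhds hc)).and (eventually_ge_atTop n)).exists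
  refine ⟨m - n, ?_⟩
  rw [Nat.add_sub_cancel' hn]
  exact pos_of_mul_pos_right hm (Real.rpow_nonneg (Nat.cast_nonneg _) _)

lemma walk_proc {Ω : Type*} [mΩ : MeasurableSpace Ω] (μ : Measure Ω) [IsProbabilityMeasure μ]
    (N : ℕ) (hN : 1 ≤ N) (α : ℝ) (hα : α ∈ Set.Icc (0:ℝ) 1)
    (r : ℕ → ℝ) (hr : ∀ n, 0 ≤ r n ∧ r n < 1)
    (Z : ℕ → Fin N → Ω → ℝ) (I : ℕ → Fin N → Ω → ℝ)
    (hZmeas : ∀ n i, Measurable (Z n i))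
    (hImeas : ∀ n i, Measurable (I n i))
    (hZ01 : ∀ n i ω, Z n i ω ∈ Set.Icc (0:ℝ) 1)
    (hI01 : ∀ n i ω, I n i ω = 0 ∨ I n i ω = 1)
    (hdyn : ∀ n i ω, Z (n + 1) i ω = (1 - r n) * Z n i ω + r n * I n i ω)
    (hcond : ∀ n (s : Finset (Fin N)),
      μ[(fun ω => ∏ i ∈ s, I n i ω) | walkFiltration Z n]
        =ᵐ[μ] fun ω => ∏ i ∈ s, ((1 - α) * Z n i ω + α * walkMean Z n ω)) :
    Proc μ (walkFiltration Z) (walkMean Z) (walkMean I) r (α ^ 2 / N) := by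
  have N0 : (0:ℝ) < N := by exact_mod_cast hN
  have hI : ∀ n i ω, I n i ω ∈ Set.Icc (0:ℝ) 1 := fun n i ω => by
    rcases hI01 n i ω with h | h <;> simp [h]
  have m01 : ∀ (W : ℕ → Fin N → Ω → ℝ), (∀ n i ω, W n i ω ∈ Set.Icc (0:ℝ) 1) →
      ∀ n ω, walkMean W n ω ∈ Set.Icc (0:ℝ) 1 := by
    intro W hW n ω
    unfold walkMean
    constructor
    · exact div_nonneg (Finset.sum_nonneg fun i _ => (hW n i ω).1) N0.le
    · rw [div_le_one N0]
      calc ∑ i, W n i ω ≤ ∑ i : Fin N, (1:ℝ) := Finset.sum_le_sum fun i _ => (hW n i ω).2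
        _ = N := by simp
  have le : ∀ n, walkFiltration Z n ≤ mΩ := fun n =>
    iSup₂_le fun k _ => iSup_le fun i => (hZmeas k i).comap_le
  have mono : Monotone (walkFiltration Z) := fun a b h =>
    iSup₂_le fun k hk => le_iSup₂_of_le k
      (Finset.mem_range.2 (by have := Finset.mem_range.1 hk; omega)) le_rfl
  have mZ : ∀ n i, Measurable[walkFiltration Z n] (Z n i) := fun n i => by
    have : MeasurableSpace.comap (Z n i) (borel ℝ) ≤ walkFiltration Z n :=
      le_iSup₂_of_le n (Finset.mem_range.2 (by omega))
        (le_iSup (fun i => MeasurableSpace.comap (Z n i) (borel ℝ)) i)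
    exact Measurable.of_comap_le this
  have bZ : ∀ n i, BM (walkFiltration Z n) (Z n i) := fun n i => BM.of01 (mZ n i) (hZ01 n i)
  have bM : ∀ n, BM (walkFiltration Z n) (walkMean Z n) := fun n => by
    have := (BM.sum Finset.univ (bZ n)).mul (BM.const (N:ℝ)⁻¹)
    exact this
  have bI : ∀ n i, BM mΩ (I n i) := fun n i => BM.of01 (hImeas n i) (hI n i)
  let p : ℕ → Fin N → Ω → ℝ := fun n i ω => (1 - α) * Z n i ω + α * walkMean Z n ω
  have bp : ∀ n i, BM (walkFiltration Z n) (p n i) := fun n i =>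
    ((BM.const _).mul (bZ n i)).add ((BM.const _).mul (bM n))
  have bp' : ∀ n i, BM mΩ (p n i) := fun n i => (bp n i).mono (le n)
  have c1 : ∀ n i (g : Ω → ℝ), BM (walkFiltration Z n) g →
      ∫ ω, g ω * I n i ω ∂μ = ∫ ω, g ω * p n i ω ∂μ := fun n i g hg =>
    BM.condInt (le n) hg (bI n i) (by simpa using hcond n {i})
  have c2 : ∀ n i j (g : Ω → ℝ), i ≠ j → BM (walkFiltration Z n) g →
      ∫ ω, g ω * (I n i ω * I n j ω) ∂μ = ∫ ω, g ω * (p n i ω * p n j ω) ∂μ :=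
    fun n i j g hij hg =>
    BM.condInt (le n) hg ((bI n i).mul (bI n j))
      (by simpa [Finset.prod_pair hij] using hcond n {i, j})
  have sp : ∀ n ω, ∑ i, p n i ω = N * walkMean Z n ω := fun n ω => by
    have : ∑ i, Z n i ω = N * walkMean Z n ω := by unfold walkMean; field_simp
    simp only [p, Finset.sum_add_distrib, ← Finset.mul_sum, this]
    simp
    ring
  have dev : ∀ n ω, walkMean I n ω - walkMean Z n ω = (N:ℝ)⁻¹ * ∑ i, (I n i ω - p n i ω) := by
    intro n ω
    rw [Finset.sum_sub_distrib, sp]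
    unfold walkMean
    field_simp
  have b3 : ∀ n i (g : Ω → ℝ), BM (walkFiltration Z n) g →
      BM mΩ (fun ω => g ω * (I n i ω - p n i ω)) := fun n i g hg =>
    (hg.mono (le n)).mul ((bI n i).sub (bp' n i))
  have d1 : ∀ n i (g : Ω → ℝ), BM (walkFiltration Z n) g →
      ∫ ω, g ω * (I n i ω - p n i ω) ∂μ = 0 := fun n i g hg => by
    simp only [mul_sub]
    rw [integral_sub ((hg.mono (le n)).mul (bI n i)).int ((hg.mono (le n)).mul (bp' n i)).int,
      c1 n i g hg, sub_self]
  refine ⟨le, mono, fun n => (bM n).1, fun n => ?_, m01 Z hZ01, m01 I hI, ?_, fun n => (hr n).1,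
    fun n => (hr n).2, ?_, ?_⟩
  · exact ((BM.sum Finset.univ (bI n)).mul (BM.const (N:ℝ)⁻¹)).1
  · intro n ω
    unfold walkMean
    simp only [hdyn, Finset.sum_add_distrib, ← Finset.mul_sum]
    ring
  · intro n g hg
    simp only [dev]
    have : ∀ ω, g ω * ((N:ℝ)⁻¹ * ∑ i, (I n i ω - p n i ω))
        = (N:ℝ)⁻¹ * ∑ i, g ω * (I n i ω - p n i ω) := fun ω => by
      rw [← Finset.mul_sum]; ring
    simp only [this]
    rw [integral_const_mul, integral_finsetSum _ (fun i _ => (b3 n i g hg).int)]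
    simp [d1 n _ g hg]
  · intro n g hg g0
    have hg' := hg.mono (le n)
    have bM' := (bM n).mono (le n)
    have diag : ∀ i, ∫ ω, g ω * ((I n i ω - p n i ω) * (I n i ω - p n i ω)) ∂μ
        = ∫ ω, g ω * (p n i ω * (1 - p n i ω)) ∂μ := fun i => by
      have e : ∀ ω, g ω * ((I n i ω - p n i ω) * (I n i ω - p n i ω))
          = (g ω * (1 - 2 * p n i ω)) * (I n i ω - p n i ω) + g ω * (p n i ω * (1 - p n i ω)) := by
        intro ω
        rcases hI01 n i ω with h | h <;> rw [h] <;> ring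
      have bx := hg.mul ((BM.const 1).sub ((BM.const 2).mul (bp n i)))
      simp only [e]
      rw [integral_add (b3 n i _ bx).int (hg'.mul ((bp' n i).mul ((BM.const 1).sub (bp' n i)))).int,
        d1 n i _ bx, zero_add]
    have off : ∀ i j, i ≠ j →
        ∫ ω, g ω * ((I n i ω - p n i ω) * (I n j ω - p n j ω)) ∂μ = 0 := fun i j hij => by
      have e : ∀ ω, g ω * ((I n i ω - p n i ω) * (I n j ω - p n j ω))
          = (g ω * (I n i ω * I n j ω) - g ω * (p n i ω * p n j ω))
            - (g ω * p n j ω) * (I n i ω - p n i ω)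
            - (g ω * p n i ω) * (I n j ω - p n j ω) := by
        intro ω; ring
      simp only [e]
      have i1 := hg'.mul ((bI n i).mul (bI n j))
      have i2 := hg'.mul ((bp' n i).mul (bp' n j))
      have i3 := b3 n i _ (hg.mul (bp n j))
      have i4 := b3 n j _ (hg.mul (bp n i))
      rw [integral_sub ((i1.sub i2).sub i3).int i4.int, integral_sub (i1.sub i2).int i3.int,
        integral_sub i1.int i2.int, c2 n i j g hij hg, d1 n i _ (hg.mul (bp n j)),
        d1 n j _ (hg.mul (bp n i))]
      ring
    have e : ∀ ω, g ω * (walkMean I n ω - walkMean Z n ω) ^ 2 = ((N:ℝ)⁻¹) ^ 2 *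
        ∑ i, ∑ j, g ω * ((I n i ω - p n i ω) * (I n j ω - p n j ω)) := fun ω => by
      rw [dev, mul_pow, sq (∑ i, (I n i ω - p n i ω)), Finset.sum_mul_sum]
      simp only [← Finset.mul_sum]
      ring
    have bb : ∀ i j, BM mΩ (fun ω => g ω * ((I n i ω - p n i ω) * (I n j ω - p n j ω))) :=
      fun i j => hg'.mul (((bI n i).sub (bp' n i)).mul ((bI n j).sub (bp' n j)))
    simp only [e]
    rw [integral_const_mul, integral_finsetSum _ (fun i _ => (BM.sum _ (bb i)).int)]
    have row : ∀ i, ∫ ω, ∑ j, g ω * ((I n i ω - p n i ω) * (I n j ω - p n j ω)) ∂μ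
        = ∫ ω, g ω * (p n i ω * (1 - p n i ω)) ∂μ := fun i => by
      rw [integral_finsetSum _ (fun j _ => (bb i j).int), Finset.sum_eq_single i
        (fun j _ hj => off i j (Ne.symm hj)) (fun h => absurd (Finset.mem_univ i) h), diag]
    simp only [row]
    have lb : ∀ i, α ^ 2 * ∫ ω, g ω * (walkMean Z n ω * (1 - walkMean Z n ω)) ∂μ
        ≤ ∫ ω, g ω * (p n i ω * (1 - p n i ω)) ∂μ := fun i => by
      rw [← integral_const_mul]
      apply integral_mono ((BM.const _).mul (hg'.mul (bM'.mul ((BM.const 1).sub bM')))).int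
        (hg'.mul ((bp' n i).mul ((BM.const 1).sub (bp' n i)))).int
      intro ω
      have hm := m01 Z hZ01 n ω
      have hz := hZ01 n i ω
      have a0 := hα.1
      have a1 : 0 ≤ 1 - α := by linarith [hα.2]
      have l1 : α * walkMean Z n ω ≤ p n i ω := by
        simp only [p]; linarith [mul_nonneg a1 hz.1]
      have l2 : α * (1 - walkMean Z n ω) ≤ 1 - p n i ω := by
        simp only [p]; linarith [mul_nonneg a1 (sub_nonneg.2 hz.2)]
      have n1 : 0 ≤ α * (1 - walkMean Z n ω) := mul_nonneg a0 (sub_nonneg.2 hm.2)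
      have n2 : 0 ≤ p n i ω := (mul_nonneg a0 hm.1).trans l1
      have := mul_le_mul_of_nonneg_left (mul_le_mul l1 l2 n1 n2) (g0 ω)
      simp only
      linarith
    have tot := Finset.sum_le_sum (s := Finset.univ) fun i _ => lb i
    rw [Finset.sum_const, Finset.card_univ, Fintype.card_fin, nsmul_eq_mul] at tot
    refine le_trans (le_of_eq ?_) (mul_le_mul_of_nonneg_left tot (sq_nonneg ((N:ℝ)⁻¹)))
    field_simp

/-- **Theorem (nature of the limit)**: for `ρ = 1`, `α > 0` and `n^γ r_n → c > 0` with
`1/2 < γ ≤ 1`, the a.s. limit `Z` of `Z_n` satisfies `P(Z ∈ {0,1}) < 1` and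
`P(Z = z) = 0` for every `z ∈ (0,1)`. -/
theorem stmt_7
    {Ω : Type*} [MeasurableSpace Ω] (μ : Measure Ω) [IsProbabilityMeasure μ]
    (N : ℕ) (hN : 1 ≤ N)
    (ρ α q : ℝ)
    (hρ : ρ ∈ Set.Icc (0:ℝ) 1) (hα : α ∈ Set.Icc (0:ℝ) 1) (hq : q ∈ Set.Icc (0:ℝ) 1)
    (r : ℕ → ℝ) (hr : ∀ n, 0 ≤ r n ∧ r n < 1)
    (Z : ℕ → Fin N → Ω → ℝ) (I : ℕ → Fin N → Ω → ℝ)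
    (hZmeas : ∀ n i, Measurable (Z n i))
    (hImeas : ∀ n i, Measurable (I n i))
    (hZ01 : ∀ n i ω, Z n i ω ∈ Set.Icc (0:ℝ) 1)
    (hI01 : ∀ n i ω, I n i ω = 0 ∨ I n i ω = 1)
    -- dynamics: `Z_{n+1}(i) = (1 - r_n) Z_n(i) + r_n (ρ I_{n+1}(i) + (1-ρ) q)`
    -- (here `I n i` stands for `I_{n+1}(i)`)
    (hdyn : ∀ n i ω, Z (n + 1) i ω
      = (1 - r n) * Z n i ω + r n * (ρ * I n i ω + (1 - ρ) * q))
    -- conditional independence of `I_{n+1}(1), …, I_{n+1}(N)` given `F_n`, together with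
    -- the conditional law `P(I_{n+1}(i) = 1 | F_n) = (1-α) Z_n(i) + α Z_n`, expressed
    -- (equivalently, for {0,1}-valued variables) through conditional product moments
    (hcond : ∀ n (s : Finset (Fin N)),
      μ[(fun ω => ∏ i ∈ s, I n i ω) | walkFiltration Z n]
        =ᵐ[μ] fun ω => ∏ i ∈ s, ((1 - α) * Z n i ω + α * walkMean Z n ω))
    -- the initial configuration is permutation invariant with mean 1/2 and E[Z_0(1-Z_0)] > 0
    (hperm : ∀ σ : Equiv.Perm (Fin N),
      μ.map (fun ω (i : Fin N) => Z 0 (σ i) ω) = μ.map (fun ω (i : Fin N) => Z 0 i ω))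
    (hmean0 : ∀ i, ∫ ω, Z 0 i ω ∂μ = 1 / 2)
    (hvar0 : 0 < ∫ ω, walkMean Z 0 ω * (1 - walkMean Z 0 ω) ∂μ)
    (hρ1 : ρ = 1) (hα0 : 0 < α)
    (c γ : ℝ) (hc : 0 < c) (hγ : 1/2 < γ ∧ γ ≤ 1)
    (hlim : Tendsto (fun n : ℕ => (n : ℝ) ^ γ * r n) atTop (nhds c))
    (Zlim : Ω → ℝ) (hZlimMeas : Measurable Zlim)
    (hZlim : ∀ᵐ ω ∂μ, Tendsto (fun n => walkMean Z n ω) atTop (nhds (Zlim ω))) :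
    μ {ω | Zlim ω = 0 ∨ Zlim ω = 1} < 1
    ∧ ∀ z ∈ Set.Ioo (0:ℝ) 1, μ {ω | Zlim ω = z} = 0 := by

  subst hρ1
  have hdyn' : ∀ n i ω, Z (n + 1) i ω = (1 - r n) * Z n i ω + r n * I n i ω := fun n i ω => by
    rw [hdyn]; ring
  have P := walk_proc μ N hN α hα r hr Z I hZmeas hImeas hZ01 hI01 hdyn' hcond
  have hS := rate_summable hγ.1 hlim
  have N0 : (0:ℝ) < N := by exact_mod_cast hN
  exact ⟨P.part1 hS hvar0 Zlim hZlimMeas hZlim,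
    P.part2 (by positivity) hS (rate_pos hc hlim) Zlim hZlimMeas hZlim⟩
end
end

section
/- Let α ∈ (0,1], let (r_n)_{n≥0} satisfy 0 ≤ r_n < 1, and suppose lim_n n^γ r_n = c for some constants c > 0 and γ ∈ (1/2, 1). Define l_n := ∏_{k=0}^{n−1} (1 − α r_k)^{−1}. Then for every T > 0, sup_{t ∈ [0,T]} | l_{⌊n + n^γ t⌋} / l_n − e^{cαt} | → 0 as n → ∞; i.e. l_{⌊n + n^γ t⌋}/l_n → e^{cαt} uniformly over compact subsets of [0, +∞). -/
open Filter Real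

lemma aux_s (α c γ : ℝ) (hα : 0 < α ∧ α ≤ 1)
    (r : ℕ → ℝ) (hr : ∀ n, 0 ≤ r n ∧ r n < 1) (hγ : 0 < γ)
    (hlim : Tendsto (fun n : ℕ => (n : ℝ) ^ γ * r n) atTop (nhds c)) :
    Tendsto (fun n : ℕ => (n : ℝ) ^ γ * (-Real.log (1 - α * r n))) atTop (nhds (c * α)) := by
  have hx : ∀ n, 0 < 1 - α * r n := by
    intro n
    nlinarith [(hr n).1, (hr n).2, hα.1, hα.2]
  have hinv : Tendsto (fun n : ℕ => (n : ℝ) ^ (-γ)) atTop (nhds 0) :=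
    (tendsto_rpow_neg_atTop hγ).comp tendsto_natCast_atTop_atTop
  have hr0 : Tendsto r atTop (nhds 0) := by
    have h := hlim.mul hinv
    rw [mul_zero] at h
    refine h.congr' ?_
    filter_upwards [eventually_gt_atTop 0] with n hn
    have hn' : (0:ℝ) < n := by exact_mod_cast hn
    have : (0:ℝ) < (n:ℝ) ^ γ := Real.rpow_pos_of_pos hn' γ
    rw [Real.rpow_neg hn'.le]
    field_simp
  have hlo := hlim.mul_const α
  have h1 : Tendsto (fun n => (1 - α * r n)⁻¹) atTop (nhds 1) := by
    have : Tendsto (fun n => 1 - α * r n) atTop (nhds (1 - α * 0)) :=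
      tendsto_const_nhds.sub (hr0.const_mul α)
    have h2 := this.inv₀ (by norm_num)
    simpa using h2
  have hhi := hlo.mul h1
  rw [mul_one] at hhi
  refine tendsto_of_tendsto_of_tendsto_of_le_of_le hlo hhi ?_ ?_
  · intro n
    have hp : (0:ℝ) ≤ (n:ℝ) ^ γ := by positivity
    have := Real.log_le_sub_one_of_pos (hx n)
    have h3 : α * r n ≤ -Real.log (1 - α * r n) := by linarith
    have := mul_le_mul_of_nonneg_left h3 hp
    simp only
    linarith
  · intro n
    have hp : (0:ℝ) ≤ (n:ℝ) ^ γ := by positivity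
    have := Real.one_sub_inv_le_log_of_pos (hx n)
    have h3 : -Real.log (1 - α * r n) ≤ α * r n * (1 - α * r n)⁻¹ := by
      have : (1 - α * r n) * (1 - α * r n)⁻¹ = 1 := mul_inv_cancel₀ (hx n).ne'
      linarith
    have := mul_le_mul_of_nonneg_left h3 hp
    simp only
    linarith

lemma aux_unif (a γ T : ℝ) (hγ : 0 < γ ∧ γ < 1) (hT : 0 < T) (s : ℕ → ℝ)
    (hs : Tendsto (fun n : ℕ => (n : ℝ) ^ γ * s n) atTop (nhds a)) (hs0 : ∀ n, 0 ≤ s n)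
    (ε : ℝ) (hε : 0 < ε) :
    ∀ᶠ n : ℕ in atTop, ∀ k : ℕ, n ≤ k → (k:ℝ) ≤ n + (n:ℝ) ^ γ * T →
      |(n:ℝ) ^ γ * s k - a| ≤ ε := by
  have hinv : Tendsto (fun n : ℕ => (n : ℝ) ^ (-(1-γ))) atTop (nhds 0) :=
    (tendsto_rpow_neg_atTop (by linarith [hγ.2])).comp tendsto_natCast_atTop_atTop
  have hq : Tendsto (fun n : ℕ => (a - ε/2) * ((1 + (n:ℝ) ^ (-(1-γ)) * T) ^ γ)⁻¹) atTop
      (nhds (a - ε/2)) := by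
    have h1 : Tendsto (fun n : ℕ => 1 + (n:ℝ) ^ (-(1-γ)) * T) atTop (nhds (1 + 0 * T)) :=
      tendsto_const_nhds.add (hinv.mul_const T)
    have h2 := (h1.rpow_const (p := γ) (Or.inr hγ.1.le)).inv₀ (by simp)
    have h3 := h2.const_mul (a - ε/2)
    simpa using h3
  have e1 := hq.eventually (lt_mem_nhds (show a - ε < a - ε/2 by linarith))
  have e2' : ∀ᶠ k : ℕ in atTop, (k:ℝ) ^ γ * s k ∈ Metric.ball a (ε/2) :=
    hs (Metric.ball_mem_nhds a (half_pos hε))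
  have e2 := eventually_forall_ge_atTop.2 e2'
  filter_upwards [e1, e2, eventually_gt_atTop 0] with n h1 h2 hn k hnk hk
  have hn' : (0:ℝ) < n := by exact_mod_cast hn
  have hk' : (n:ℝ) ≤ k := by exact_mod_cast hnk
  have h3 := h2 k hnk
  simp only [Metric.mem_ball, Real.dist_eq, abs_lt] at h3
  have hpow : (n:ℝ) ^ γ ≤ (k:ℝ) ^ γ := Real.rpow_le_rpow hn'.le hk' hγ.1.le
  set q := (1 + (n:ℝ) ^ (-(1-γ)) * T) ^ γ with hqd
  have hqpos : 0 < q := by positivity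
  have hkq : (k:ℝ) ^ γ ≤ (n:ℝ) ^ γ * q := by
    rw [hqd, ← Real.mul_rpow hn'.le (by positivity)]
    refine Real.rpow_le_rpow (by positivity) ?_ hγ.1.le
    have : (n:ℝ) * (n:ℝ) ^ (-(1-γ)) = (n:ℝ) ^ γ := by
      nth_rw 1 [← Real.rpow_one (n:ℝ)]
      rw [← Real.rpow_add hn']
      congr 1; ring
    calc (k:ℝ) ≤ n + (n:ℝ) ^ γ * T := hk
      _ = _ := by rw [← this]; ring
  have hu := mul_le_mul_of_nonneg_right hpow (hs0 k)
  have hl := mul_le_mul_of_nonneg_right hkq (hs0 k)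
  rw [abs_le]
  constructor
  · have : (a - ε/2) * q⁻¹ ≤ (n:ℝ) ^ γ * s k := by
      rw [← div_eq_mul_inv, div_le_iff₀ hqpos]
      nlinarith
    linarith
  · linarith

lemma aux_log (a γ T : ℝ) (hγ : 0 < γ ∧ γ < 1) (hT : 0 < T) (s : ℕ → ℝ)
    (hs : Tendsto (fun n : ℕ => (n : ℝ) ^ γ * s n) atTop (nhds a)) (hs0 : ∀ n, 0 ≤ s n)
    (ε : ℝ) (hε : 0 < ε) :
    ∀ᶠ n : ℕ in atTop, ∀ t ∈ Set.Icc 0 T,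
      |∑ k ∈ Finset.Ico n ⌊(n : ℝ) + (n : ℝ) ^ γ * t⌋₊, s k - a * t| ≤ ε := by
  have hinv : Tendsto (fun n : ℕ => |a| * (n : ℝ) ^ (-γ)) atTop (nhds 0) := by
    have := ((tendsto_rpow_neg_atTop hγ.1).comp tendsto_natCast_atTop_atTop).const_mul |a|
    simpa using this
  have e0 := hinv.eventually (gt_mem_nhds (half_pos hε))
  have e1 := aux_unif a γ T hγ hT s hs hs0 (ε / 2 / T) (by positivity)
  filter_upwards [e0, e1, eventually_gt_atTop 0] with n h0 h1 hn t ht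
  have hn' : (0:ℝ) < n := by exact_mod_cast hn
  have hN : (0:ℝ) < (n:ℝ) ^ γ := Real.rpow_pos_of_pos hn' γ
  set N := (n:ℝ) ^ γ with hNd
  have hNt : 0 ≤ N * t := mul_nonneg hN.le ht.1
  have hNT : N * t ≤ N * T := mul_le_mul_of_nonneg_left ht.2 hN.le
  set m := ⌊(n : ℝ) + N * t⌋₊ with hm
  have hnm : n ≤ m := Nat.le_floor (by linarith)
  have hm1 : (m:ℝ) ≤ n + N * t := Nat.floor_le (by linarith)
  have hm2 : (n:ℝ) + N * t < m + 1 := Nat.lt_floor_add_one _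
  have hsum : |∑ k ∈ Finset.Ico n m, (N * s k - a)| ≤ ((m:ℝ) - n) * (ε / 2 / T) := by
    refine (Finset.abs_sum_le_sum_abs _ _).trans ?_
    refine (Finset.sum_le_card_nsmul _ _ (ε / 2 / T) ?_).trans ?_
    · intro k hk
      rw [Finset.mem_Ico] at hk
      refine h1 k hk.1 ?_
      have : (k:ℝ) ≤ m := by exact_mod_cast hk.2.le
      linarith
    · rw [Nat.card_Ico, nsmul_eq_mul, Nat.cast_sub hnm]
  rw [Finset.sum_sub_distrib, ← Finset.mul_sum, Finset.sum_const, Nat.card_Ico, nsmul_eq_mul,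
    Nat.cast_sub hnm] at hsum
  set S := ∑ k ∈ Finset.Ico n m, s k
  have hb : ((m:ℝ) - n) * (ε / 2 / T) ≤ N * (ε / 2) := by
    calc ((m:ℝ) - n) * (ε / 2 / T) ≤ (N * T) * (ε / 2 / T) :=
          mul_le_mul_of_nonneg_right (by linarith) (by positivity)
      _ = N * (ε / 2) := by field_simp
  have h0' : |a| ≤ N * (ε / 2) := by
    rw [Real.rpow_neg hn'.le, ← div_eq_mul_inv, div_lt_iff₀ hN] at h0
    linarith
  have h5 : |((m:ℝ) - n - N * t) * a| ≤ |a| := by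
    rw [abs_mul]
    have : |(m:ℝ) - n - N * t| ≤ 1 := by rw [abs_le]; constructor <;> linarith
    nlinarith [abs_nonneg a]
  have h6 : |N * (S - a * t)| ≤ N * ε := by
    have : N * (S - a * t) = (N * S - ((m:ℝ) - n) * a) + ((m:ℝ) - n - N * t) * a := by ring
    rw [this]
    refine (abs_add_le _ _).trans ?_
    linarith
  rw [abs_mul, abs_of_pos hN] at h6
  exact le_of_mul_le_mul_left h6 hN

/-- **Lemma (time change, case 1/2 < γ < 1)**: if `0 ≤ r_n < 1`, `α ∈ (0,1]` and
`n^γ r_n → c > 0` with `1/2 < γ < 1`, then, setting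
`l_n := ∏_{k<n} (1 - α r_k)⁻¹`, the ratio `l_{⌊n + n^γ t⌋} / l_n` converges to
`e^{cαt}` uniformly over compact subsets of `[0, +∞)`. -/
theorem stmt_8
    (α c γ : ℝ) (hα : 0 < α ∧ α ≤ 1)
    (r : ℕ → ℝ) (hr : ∀ n, 0 ≤ r n ∧ r n < 1)
    (hc : 0 < c) (hγ : 1/2 < γ ∧ γ < 1)
    (hlim : Tendsto (fun n : ℕ => (n : ℝ) ^ γ * r n) atTop (nhds c))
    (l : ℕ → ℝ)
    (hl : ∀ n, l n = ∏ k ∈ Finset.range n, (1 - α * r k)⁻¹) :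
    ∀ T > 0, TendstoUniformlyOn
      (fun (n : ℕ) (t : ℝ) => l ⌊(n : ℝ) + (n : ℝ) ^ γ * t⌋₊ / l n)
      (fun t => Real.exp (c * α * t)) atTop (Set.Icc 0 T) := by
  intro T hT
  have hγ0 : 0 < γ ∧ γ < 1 := ⟨by linarith [hγ.1], hγ.2⟩
  have hx : ∀ n, 0 < 1 - α * r n := by
    intro n
    nlinarith [(hr n).1, (hr n).2, hα.1, hα.2]
  have hs := aux_s α c γ hα r hr hγ0.1 hlim
  have hs0 : ∀ n, 0 ≤ -Real.log (1 - α * r n) := by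
    intro n
    have := Real.log_nonpos (hx n).le (by nlinarith [(hr n).1, hα.1])
    linarith
  rw [Metric.tendstoUniformlyOn_iff]
  intro ε hε
  set M := Real.exp (c * α * T) with hM
  have hMpos : 0 < M := Real.exp_pos _
  have hδ : 0 < min 1 (ε / (4 * M)) := by positivity
  filter_upwards [aux_log (c * α) γ T hγ0 hT _ hs hs0 _ hδ, eventually_gt_atTop 0] with n h hn t ht
  have h1 := h t ht
  have hN : (0:ℝ) ≤ (n:ℝ) ^ γ := by positivity
  have hnm : n ≤ ⌊(n : ℝ) + (n : ℝ) ^ γ * t⌋₊ :=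
    Nat.le_floor (by linarith [mul_nonneg hN ht.1])
  set m := ⌊(n : ℝ) + (n : ℝ) ^ γ * t⌋₊
  have hratio : l m / l n = Real.exp (∑ k ∈ Finset.Ico n m, -Real.log (1 - α * r k)) := by
    rw [Real.exp_sum, hl m, hl n, ← Finset.prod_range_mul_prod_Ico _ hnm,
      mul_div_cancel_left₀]
    · refine Finset.prod_congr rfl fun k _ => ?_
      rw [Real.exp_neg, Real.exp_log (hx k)]
    · exact Finset.prod_ne_zero_iff.2 fun k _ => inv_ne_zero (hx k).ne'
  rw [hratio]
  set S := ∑ k ∈ Finset.Ico n m, -Real.log (1 - α * r k)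
  have h2 := Real.abs_exp_sub_one_le (h1.trans (min_le_left _ _))
  have h3 := h1.trans (min_le_right _ _)
  have hE : Real.exp (c * α * t) ≤ M := by
    apply Real.exp_le_exp.2
    exact mul_le_mul_of_nonneg_left ht.2 (mul_pos hc hα.1).le
  rw [dist_comm, Real.dist_eq]
  have h4 : Real.exp S - Real.exp (c * α * t)
      = Real.exp (c * α * t) * (Real.exp (S - c * α * t) - 1) := by
    rw [mul_sub, ← Real.exp_add]
    ring_nf
  rw [h4, abs_mul, abs_of_pos (Real.exp_pos _)]
  calc _ ≤ M * (2 * (ε / (4 * M))) :=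
        mul_le_mul hE (by linarith) (abs_nonneg _) hMpos.le
    _ = ε / 2 := by field_simp; norm_num
    _ < ε := by linarith
end

section
/- Let α ∈ (0,1], let (r_n)_{n≥0} satisfy 0 ≤ r_n < 1, and suppose lim_n n r_n = c for some constant c > 0 with 2cα > 1. Define l_n := ∏_{k=0}^{n−1} (1 − α r_k)^{−1}. Then for every T > 0, sup_{t ∈ [0,T]} | l_{⌊n + n t⌋} / l_n − (1 + t)^{cα} | → 0 as n → ∞; i.e. l_{⌊n + nt⌋}/l_n → (1+t)^{cα} uniformly over compact subsets of [0, +∞). -/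
open Filter Real

theorem aux_incr (a β : ℝ) (r : ℕ → ℝ) (ha : 0 < a ∧ a ≤ 1) (hr : ∀ n, 0 ≤ r n ∧ r n < 1)
    (hlim : Tendsto (fun n : ℕ => (n : ℝ) * (a * r n)) atTop (nhds β)) :
    Tendsto (fun n : ℕ => (n : ℝ) * (-Real.log (1 - a * r n) - β * (Real.log ((n:ℝ)+1) - Real.log n)))
      atTop (nhds 0) := by
  have hx : ∀ n, 0 ≤ a * r n ∧ a * r n < 1 := fun n =>
    ⟨mul_nonneg ha.1.le (hr n).1, by nlinarith [hr n, ha.1, ha.2]⟩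
  have h0 : Tendsto (fun n : ℕ => a * r n) atTop (nhds 0) := by
    have h1 := hlim.mul (tendsto_inv_atTop_nhds_zero_nat (𝕜 := ℝ))
    rw [mul_zero] at h1
    refine h1.congr' ?_
    filter_upwards [eventually_gt_atTop 0] with n hn
    have : (n:ℝ) ≠ 0 := by positivity
    field_simp
  have hA : Tendsto (fun n : ℕ => (n : ℝ) * (-Real.log (1 - a * r n))) atTop (nhds β) := by
    have h2 : Tendsto (fun n : ℕ => (n : ℝ) * (a * r n) / (1 - a * r n)) atTop (nhds β) := by
      have := hlim.div (tendsto_const_nhds (x := (1:ℝ)) |>.sub h0) (by norm_num)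
      rw [sub_zero, div_one] at this; exact this
    refine tendsto_of_tendsto_of_tendsto_of_le_of_le hlim h2 ?_ ?_
    · intro n
      have := Real.log_le_sub_one_of_pos (x := 1 - a * r n) (by linarith [(hx n).2])
      exact mul_le_mul_of_nonneg_left (by linarith) (Nat.cast_nonneg n)
    · intro n
      have hp : 0 < 1 - a * r n := by linarith [(hx n).2]
      have := Real.one_sub_inv_le_log_of_pos hp
      have e : (a * r n) / (1 - a * r n) = (1 - a * r n)⁻¹ - 1 := by field_simp; ring
      show (n:ℝ) * _ ≤ (n:ℝ) * (a * r n) / (1 - a * r n)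
      rw [mul_div_assoc, e]
      exact mul_le_mul_of_nonneg_left (by linarith) (Nat.cast_nonneg n)
  have hB : Tendsto (fun n : ℕ => (n : ℝ) * (Real.log ((n:ℝ)+1) - Real.log n)) atTop (nhds 1) := by
    refine tendsto_of_tendsto_of_tendsto_of_le_of_le' (tendsto_natCast_div_add_atTop (1:ℝ))
      tendsto_const_nhds ?_ ?_
    · filter_upwards [eventually_gt_atTop 0] with n hn
      have hn' : (0:ℝ) < n := by positivity
      have := Real.one_sub_inv_le_log_of_pos (x := ((n:ℝ)+1)/n) (by positivity)
      rw [Real.log_div (by positivity) (by positivity)] at this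
      have e : (n:ℝ) / (n + 1) = n * (1 - (((n:ℝ)+1)/n)⁻¹) := by field_simp; ring
      rw [e]
      exact mul_le_mul_of_nonneg_left this hn'.le
    · filter_upwards [eventually_gt_atTop 0] with n hn
      have hn' : (0:ℝ) < n := by positivity
      have := Real.log_le_sub_one_of_pos (x := ((n:ℝ)+1)/n) (by positivity)
      rw [Real.log_div (by positivity) (by positivity)] at this
      have e : (1:ℝ) = n * (((n:ℝ)+1)/n - 1) := by field_simp; ring
      calc _ ≤ n * (((n:ℝ)+1)/n - 1) := mul_le_mul_of_nonneg_left this hn'.le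
        _ = 1 := e.symm
  have := hA.sub (hB.const_mul β)
  rw [mul_one, sub_self] at this
  refine this.congr fun n => ?_
  ring

theorem aux_sum (g : ℕ → ℝ) (ε : ℝ) (n : ℕ) (hn : 0 < n) (hε : 0 ≤ ε)
    (h : ∀ k ≥ n, |(k:ℝ) * (g (k+1) - g k)| ≤ ε) (j : ℕ) :
    |g (n + j) - g n| ≤ ε * j / n := by
  have hn' : (0:ℝ) < n := by positivity
  induction j with
  | zero => simp
  | succ j ih =>
    have h1 := h (n+j) (by omega)
    have h2 : |g (n+j+1) - g (n+j)| ≤ ε / n := by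
      rw [le_div_iff₀ hn']
      rw [abs_mul, abs_of_nonneg (Nat.cast_nonneg _)] at h1
      push_cast at h1
      nlinarith [abs_nonneg (g (n+j+1) - g (n+j)), (Nat.cast_nonneg j : (0:ℝ) ≤ j),
        mul_nonneg (Nat.cast_nonneg j : (0:ℝ) ≤ j) (abs_nonneg (g (n+j+1) - g (n+j)))]
    have h3 := abs_add_le (g (n+j+1) - g (n+j)) (g (n+j) - g n)
    rw [sub_add_sub_cancel] at h3
    have e : ε * ((j+1 : ℕ):ℝ) / n = ε / n + ε * j / n := by push_cast; ring
    rw [e]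
    exact h3.trans (add_le_add h2 ih)

/-- **Lemma (time change, case γ = 1, 2cα > 1)**: if `0 ≤ r_n < 1`, `α ∈ (0,1]` and
`n r_n → c > 0` with `2cα > 1`, then, setting `l_n := ∏_{k<n} (1 - α r_k)⁻¹`,
the ratio `l_{⌊n + n t⌋} / l_n` converges to `(1+t)^{cα}` uniformly over
compact subsets of `[0, +∞)`. -/
theorem stmt_9
    (α c : ℝ) (hα : 0 < α ∧ α ≤ 1)
    (r : ℕ → ℝ) (hr : ∀ n, 0 ≤ r n ∧ r n < 1)
    (hc : 0 < c) (hcα : 1 < 2 * c * α)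
    (hlim : Tendsto (fun n : ℕ => (n : ℝ) * r n) atTop (nhds c))
    (l : ℕ → ℝ)
    (hl : ∀ n, l n = ∏ k ∈ Finset.range n, (1 - α * r k)⁻¹) :
    ∀ T > 0, TendstoUniformlyOn
      (fun (n : ℕ) (t : ℝ) => l ⌊(n : ℝ) + (n : ℝ) * t⌋₊ / l n)
      (fun t => (1 + t) ^ (c * α)) atTop (Set.Icc 0 T) := by
  intro T hT
  have hβ : 0 < c * α := mul_pos hc hα.1
  have hx : ∀ n, 0 < 1 - α * r n := fun n => by nlinarith [hr n, hα.1, hα.2]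
  have hlpos : ∀ n, 0 < l n := fun n => by
    rw [hl]; exact Finset.prod_pos fun k _ => inv_pos.2 (hx k)
  have hstep : ∀ n, Real.log (l (n+1)) - Real.log (l n) = -Real.log (1 - α * r n) := fun n => by
    have : l (n+1) = l n * (1 - α * r n)⁻¹ := by rw [hl, hl, Finset.prod_range_succ]
    rw [this, Real.log_mul (hlpos n).ne' (inv_pos.2 (hx n)).ne', Real.log_inv]; ring
  have hinc := aux_incr α (c * α) r hα hr (by
    refine (hlim.mul_const α).congr fun n => ?_
    ring)
  obtain ⟨g, hg⟩ : ∃ g : ℕ → ℝ, ∀ n, g n = Real.log (l n) - c * α * Real.log n :=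
    ⟨_, fun _ => rfl⟩
  have hinc' : Tendsto (fun n : ℕ => (n:ℝ) * (g (n+1) - g n)) atTop (nhds 0) := by
    refine hinc.congr fun n => ?_
    rw [hg, hg, ← hstep]; push_cast; ring
  rw [Metric.tendstoUniformlyOn_iff]
  intro ε hε
  set M := (1 + T) ^ (c * α) with hM
  have hMpos : 0 < M := by positivity
  obtain ⟨δ, hδ, hδ1, hδε⟩ : ∃ δ : ℝ, 0 < δ ∧ δ ≤ 1 ∧ M * (2 * δ) < ε := by
    refine ⟨min 1 (ε / (4 * M)), by positivity, min_le_left _ _, ?_⟩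
    have := min_le_right 1 (ε / (4 * M))
    rw [le_div_iff₀ (by positivity)] at this
    nlinarith
  have hη : 0 < δ / (2 * T) := by positivity
  obtain ⟨N, hN⟩ := (Metric.tendsto_atTop.1 hinc') _ hη
  have hinv : ∀ᶠ n : ℕ in atTop, c * α * ((n:ℝ)⁻¹) < δ / 2 := by
    have := (tendsto_inv_atTop_nhds_zero_nat (𝕜 := ℝ)).const_mul (c * α)
    rw [mul_zero] at this
    exact this.eventually_lt_const (by positivity)
  filter_upwards [hinv, eventually_ge_atTop N, eventually_gt_atTop 0] with n hn1 hnN hn0 t ht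
  have hn' : (0:ℝ) < n := by positivity
  obtain ⟨ht0, htT⟩ := ht
  have hnt : 0 ≤ (n:ℝ) * t := by positivity
  have hm1 : n ≤ ⌊(n : ℝ) + (n : ℝ) * t⌋₊ := Nat.le_floor (by linarith)
  have hm2 : (⌊(n : ℝ) + (n : ℝ) * t⌋₊ : ℝ) ≤ (n : ℝ) + (n : ℝ) * t := Nat.floor_le (by linarith)
  have hm3 := Nat.lt_floor_add_one ((n : ℝ) + (n : ℝ) * t)
  set m := ⌊(n : ℝ) + (n : ℝ) * t⌋₊ with hm
  have hm1' : (n:ℝ) ≤ m := by exact_mod_cast hm1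
  have hm' : (0:ℝ) < m := by linarith
  have hgd : |g m - g n| ≤ δ / 2 := by
    have := aux_sum g (δ / (2 * T)) n hn0 hη.le (fun k hk => by
      have := hN k (hnN.trans hk)
      rw [Real.dist_eq, sub_zero] at this
      exact this.le) (m - n)
    rw [Nat.add_sub_cancel' hm1, Nat.cast_sub hm1] at this
    refine this.trans ?_
    rw [div_le_iff₀ hn']
    have h5 : (m:ℝ) - n ≤ n * T := by nlinarith
    calc δ / (2 * T) * ((m:ℝ) - n) ≤ δ / (2 * T) * (n * T) := mul_le_mul_of_nonneg_left h5 hη.le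
      _ = δ / 2 * n := by field_simp
  -- log comparison
  have hlog0 : Real.log m ≤ Real.log n + Real.log (1 + t) := by
    rw [← Real.log_mul hn'.ne' (by positivity)]
    exact Real.log_le_log hm' (by linarith)
  have hlog1 : Real.log n + Real.log (1 + t) - Real.log m ≤ (n:ℝ)⁻¹ := by
    rw [← Real.log_mul hn'.ne' (by positivity), ← Real.log_div (by positivity) hm'.ne']
    refine (Real.log_le_sub_one_of_pos (by positivity)).trans ?_
    have : (n:ℝ) * (1 + t) / m - 1 = (n * (1 + t) - m) / m := by field_simp
    rw [this, ← one_div]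
    exact div_le_div₀ (by norm_num) (by linarith) hn' hm1'
  set D := Real.log (l m) - Real.log (l n) - c * α * Real.log (1 + t) with hD
  have hDb : |D| ≤ δ := by
    have e : D = (g m - g n) - c * α * (Real.log n + Real.log (1 + t) - Real.log m) := by
      rw [hD, hg, hg]; ring
    have h6 := mul_le_mul_of_nonneg_left hlog1 hβ.le
    have h7 : 0 ≤ c * α * (Real.log n + Real.log (1 + t) - Real.log m) :=
      mul_nonneg hβ.le (by linarith)
    rw [e]
    rw [abs_le] at hgd ⊢
    constructor <;> linarith [hgd.1, hgd.2]
  have hquot : l m / l n = (1 + t) ^ (c * α) * Real.exp D := by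
    rw [Real.rpow_def_of_pos (by positivity), ← Real.exp_add,
      ← Real.exp_log (div_pos (hlpos m) (hlpos n)), Real.log_div (hlpos m).ne' (hlpos n).ne', hD]
    congr 1; ring
  have hexp := Real.abs_exp_sub_one_le (hDb.trans hδ1)
  have hle : (1 + t) ^ (c * α) ≤ M := Real.rpow_le_rpow (by positivity) (by linarith) hβ.le
  have hp : 0 ≤ (1 + t) ^ (c * α) := by positivity
  show dist ((1 + t) ^ (c * α)) (l m / l n) < ε
  rw [dist_comm, Real.dist_eq, hquot]
  have e : (1 + t) ^ (c * α) * Real.exp D - (1 + t) ^ (c * α)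
    = (1 + t) ^ (c * α) * (Real.exp D - 1) := by ring
  rw [e, abs_mul, abs_of_nonneg hp]
  calc _ ≤ M * (2 * δ) := mul_le_mul hle (by linarith) (abs_nonneg _) hMpos.le
    _ < ε := hδε
end

section
/- Let (x_n)_{n≥0} be a sequence of nonnegative real numbers satisfying the recursion x_{n+1} = (1 − a r_n) x_n + K_n r_n², where a > 0, r_n ≥ 0, and 0 ≤ K_n ≤ K for some constant K. If Σ_n r_n = +∞ and Σ_n r_n² < +∞, then lim_{n→∞} x_n = 0. -/
open Filter

/-- **Technical lemma** (Lemma A.1): if a sequence of nonnegative reals satisfies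
`x_{n+1} = (1 - a r_n) x_n + K_n r_n²` with `a > 0`, `r_n ≥ 0`, `0 ≤ K_n ≤ K`,
`Σ r_n = +∞` and `Σ r_n² < +∞`, then `x_n → 0`. -/
theorem stmt_10
    (x r K_ : ℕ → ℝ) (a K : ℝ)
    (ha : 0 < a)
    (hx : ∀ n, 0 ≤ x n)
    (hr : ∀ n, 0 ≤ r n)
    (hK : ∀ n, 0 ≤ K_ n ∧ K_ n ≤ K)
    (hrec : ∀ n, x (n + 1) = (1 - a * r n) * x n + K_ n * (r n) ^ 2)
    (hrdiv : ¬ Summable r)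
    (hrsq : Summable (fun n => (r n) ^ 2)) :
    Tendsto x atTop (nhds 0) := by
  have hb0 : ∀ n, 0 ≤ K_ n * (r n) ^ 2 := fun n => mul_nonneg (hK n).1 (sq_nonneg _)
  have hb : Summable (fun n => K_ n * (r n) ^ 2) :=
    Summable.of_nonneg_of_le hb0
      (fun n => mul_le_mul_of_nonneg_right (hK n).2 (sq_nonneg _)) (hrsq.mul_left K)
  have hc0 : ∀ n, 0 ≤ a * r n * x n := fun n => mul_nonneg (mul_nonneg ha.le (hr n)) (hx n)
  have hsum : ∀ n, x n = x 0 + ∑ i ∈ Finset.range n, K_ i * (r i) ^ 2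
      - ∑ i ∈ Finset.range n, a * r i * x i := by
    intro n
    induction n with
    | zero => simp
    | succ k ih =>
      rw [Finset.sum_range_succ, Finset.sum_range_succ]
      linarith [hrec k]
  have hc : Summable (fun n => a * r n * x n) := by
    apply summable_of_sum_range_le (c := x 0 + ∑' i, K_ i * (r i) ^ 2) hc0
    intro n
    have h1 := hb.sum_le_tsum (Finset.range n) (fun i _ => hb0 i)
    linarith [hsum n, hx n]
  obtain ⟨L, hL⟩ : ∃ L, Tendsto x atTop (nhds L) := by
    refine ⟨x 0 + ∑' i, K_ i * (r i) ^ 2 - ∑' i, a * r i * x i, ?_⟩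
    rw [show x = fun n => x 0 + ∑ i ∈ Finset.range n, K_ i * (r i) ^ 2
      - ∑ i ∈ Finset.range n, a * r i * x i from funext hsum]
    have h := (hb.hasSum.tendsto_sum_nat.const_add (x 0)).sub hc.hasSum.tendsto_sum_nat
    rw [← funext hsum] at h ⊢
    exact h
  have hL0 : 0 ≤ L := ge_of_tendsto' hL hx
  rcases hL0.eq_or_lt with h | hpos
  · rw [h]; exact hL
  · exfalso
    apply hrdiv
    have hev : ∀ᶠ n in atTop, L / 2 < x n := hL.eventually (lt_mem_nhds (by linarith))
    obtain ⟨N, hN⟩ := eventually_atTop.1 hev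
    rw [← summable_nat_add_iff N]
    have h2 := ((summable_nat_add_iff N).2 hc).mul_left (2 / (a * L))
    refine Summable.of_nonneg_of_le (fun n => hr _) (fun n => ?_) h2
    have h3 := hN (n + N) (by omega)
    have h4 : 2 / (a * L) * (a * r (n + N) * x (n + N)) = r (n + N) * (2 * x (n + N) / L) := by
      field_simp
    show r (n + N) ≤ 2 / (a * L) * (a * r (n + N) * x (n + N))
    rw [h4]
    apply le_mul_of_one_le_right (hr _)
    rw [le_div_iff₀ hpos]
    linarith
end

section
/- Suppose ρ = 1, α > 0, and lim_n n^γ r_n = c for some constants c > 0 and γ ∈ (1/2, 1). Let Z be the almost sure limit of Z_n. Then for every i ∈ {1,…,N}, lim_{n→∞} n^γ · E[(Z_n(i) − Z_n)²] = (1 − 1/N) · (c/(2α)) · E[Z(1 − Z)]. -/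
open MeasureTheory Filter Real

noncomputable section

lemma aux_tendsto (y a s : ℕ → ℝ) (L : ℝ)
    (ha : ∀ᶠ n in atTop, 0 ≤ a n ∧ a n ≤ 1)
    (hy : ∀ᶠ n in atTop, y (n+1) = (1 - a n) * y n + a n * s n)
    (hs : Tendsto s atTop (nhds L)) (hsum : ¬ Summable a) :
    Tendsto y atTop (nhds L) := by
  rw [Metric.tendsto_atTop]
  intro ε hε
  have hs' : ∀ᶠ n in atTop, |s n - L| < ε / 2 := by
    have := (Metric.tendsto_nhds.1 hs) (ε/2) (by positivity)
    simpa [Real.dist_eq] using this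
  obtain ⟨n0, h0⟩ := eventually_atTop.1 (ha.and (hy.and hs'))
  have hns : ¬ Summable (fun k => a (k + n0)) := by
    rwa [summable_nat_add_iff n0]
  have hT := (not_summable_iff_tendsto_nat_atTop_of_nonneg
    (fun k => (h0 (k + n0) (by omega)).1.1)).1 hns
  have hb : ∀ m, |y (m + n0) - L| ≤ ε/2 + |y n0 - L| * Real.exp (-(∑ k ∈ Finset.range m, a (k + n0))) := by
    intro m
    induction m with
    | zero => simp; linarith
    | succ m ih =>
      obtain ⟨⟨h1, h2⟩, h3, h4⟩ := h0 (m + n0) (by omega)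
      have e : m + 1 + n0 = m + n0 + 1 := by omega
      rw [e, h3, Finset.sum_range_succ, neg_add, Real.exp_add]
      set E := Real.exp (-(∑ k ∈ Finset.range m, a (k + n0)))
      have hE : 0 ≤ E := (Real.exp_pos _).le
      have hx : 1 - a (m+n0) ≤ Real.exp (-a (m + n0)) := by
        have := Real.add_one_le_exp (-a (m+n0)); linarith
      have : (1 - a (m + n0)) * y (m + n0) + a (m + n0) * s (m + n0) - L
        = (1 - a (m+n0)) * (y (m+n0) - L) + a (m+n0) * (s (m+n0) - L) := by ring
      rw [this]
      calc _ ≤ |(1 - a (m+n0)) * (y (m+n0) - L)| + |a (m+n0) * (s (m+n0) - L)| := abs_add_le _ _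
        _ = (1 - a (m+n0)) * |y (m+n0) - L| + a (m+n0) * |s (m+n0) - L| := by
          rw [abs_mul, abs_mul, abs_of_nonneg h1, abs_of_nonneg (sub_nonneg.2 h2)]
        _ ≤ (1 - a (m+n0)) * (ε/2 + |y n0 - L| * E) + a (m+n0) * (ε/2) := by
          have := sub_nonneg.2 h2
          gcongr
        _ = ε/2 + |y n0 - L| * (E * (1 - a (m+n0))) := by ring
        _ ≤ _ := by gcongr
  have hlim0 : Tendsto (fun m => ε/2 + |y n0 - L| * Real.exp (-(∑ k ∈ Finset.range m, a (k + n0)))) atTop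
      (nhds (ε/2 + |y n0 - L| * 0)) := by
    refine tendsto_const_nhds.add (tendsto_const_nhds.mul ?_)
    exact Real.tendsto_exp_neg_atTop_nhds_zero.comp hT
  have : ∀ᶠ m in atTop, ε/2 + |y n0 - L| * Real.exp (-(∑ k ∈ Finset.range m, a (k + n0))) < ε :=
    hlim0.eventually_lt_const (by linarith)
  obtain ⟨m0, hm0⟩ := eventually_atTop.1 this
  refine ⟨m0 + n0, fun n hn => ?_⟩
  have h1 := hb (n - n0)
  have h2 := hm0 (n - n0) (by omega)
  rw [Nat.sub_add_cancel (by omega)] at h1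
  rw [Real.dist_eq]; linarith

lemma aux_pos (a : ℕ → ℝ) (γ L : ℝ) (hL : 0 < L)
    (h : Tendsto (fun n : ℕ => (n:ℝ)^γ * a n) atTop (nhds L)) :
    ∀ᶠ n in atTop, 0 < a n := by
  filter_upwards [h.eventually_const_lt hL, eventually_gt_atTop 0] with n h1 h2
  have : 0 < (n:ℝ)^γ := Real.rpow_pos_of_pos (by exact_mod_cast h2) _
  exact (pos_iff_pos_of_mul_pos h1).1 this

lemma aux_not_summable (a : ℕ → ℝ) (γ L : ℝ) (hL : 0 < L) (hγ : γ < 1)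
    (h : Tendsto (fun n : ℕ => (n:ℝ)^γ * a n) atTop (nhds L)) : ¬ Summable a := by
  intro hs
  have h2 : Summable (fun n : ℕ => 1 / (n:ℝ)^γ) := by
    refine Summable.of_norm_bounded_eventually_nat (hs.mul_left (2/L)) ?_
    filter_upwards [h.eventually_const_lt (half_lt_self hL), eventually_gt_atTop 0] with n h1 h2
    have hp : 0 < (n:ℝ)^γ := Real.rpow_pos_of_pos (by exact_mod_cast h2) _
    rw [Real.norm_of_nonneg (by positivity), div_le_iff₀ hp]
    have : 2 / L * a n * (n:ℝ)^γ = 2 / L * ((n:ℝ)^γ * a n) := by ring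
    rw [this]
    calc (1:ℝ) = 2 / L * (L/2) := by field_simp
      _ ≤ _ := by gcongr
  rw [Real.summable_one_div_nat_rpow] at h2
  linarith

lemma aux_r (r : ℕ → ℝ) (γ c : ℝ) (hγ : 0 < γ)
    (h : Tendsto (fun n : ℕ => (n:ℝ)^γ * r n) atTop (nhds c)) :
    Tendsto r atTop (nhds 0) := by
  have h1 : Tendsto (fun n : ℕ => (n:ℝ)^(-γ)) atTop (nhds 0) :=
    (tendsto_rpow_neg_atTop hγ).comp tendsto_natCast_atTop_atTop
  have := h1.mul h
  rw [zero_mul] at this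
  refine this.congr' ?_
  filter_upwards [eventually_gt_atTop 0] with n h2
  have hp : 0 < (n:ℝ) := by exact_mod_cast h2
  rw [← mul_assoc, ← Real.rpow_add hp]; simp

lemma aux_A (r x w : ℕ → ℝ) (α γ c K : ℝ) (hα0 : 0 < α) (hα1 : α ≤ 1) (hc : 0 < c) (hγ0 : 0 < γ) (hγ : γ < 1)
    (hr : ∀ n, 0 ≤ r n ∧ r n < 1)
    (hlim : Tendsto (fun n : ℕ => (n:ℝ)^γ * r n) atTop (nhds c))
    (hx : ∀ n, x (n+1) = ((1 - r n)^2 + 2 * r n * (1 - r n) * (1 - α)) * x n + (r n)^2 * w n)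
    (hw : ∀ n, |w n| ≤ K) : Tendsto x atTop (nhds 0) := by
  have hr0 := aux_r r γ c hγ0 hlim
  have hd : Tendsto (fun n => 2 * α - (2 * α - 1) * r n) atTop (nhds (2 * α)) := by
    simpa using (tendsto_const_nhds (x := 2 * α)).sub (hr0.const_mul (2*α-1))
  have ha : Tendsto (fun n : ℕ => (n:ℝ)^γ * (r n * (2 * α - (2 * α - 1) * r n))) atTop (nhds (c * (2*α))) := by
    refine (hlim.mul hd).congr fun n => by ring
  refine aux_tendsto x (fun n => r n * (2 * α - (2 * α - 1) * r n))
    (fun n => r n * w n / (2 * α - (2 * α - 1) * r n)) 0 ?_ ?_ ?_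
    (aux_not_summable _ γ _ (by positivity) hγ ha)
  · filter_upwards [aux_pos _ γ _ (by positivity) ha] with n hn
    refine ⟨hn.le, ?_⟩
    obtain ⟨h1, h2⟩ := hr n
    have h3 : 0 ≤ r n * (1 - r n) * (1 - α) :=
      mul_nonneg (mul_nonneg h1 (by linarith)) (by linarith)
    nlinarith [sq_nonneg (1 - r n)]
  · filter_upwards [hd.eventually_const_lt (show 0 < 2 * α by positivity)] with n hn
    have e : r n * (2 * α - (2 * α - 1) * r n) * (r n * w n / (2 * α - (2 * α - 1) * r n)) = (r n)^2 * w n := by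
      rw [mul_assoc, mul_div_cancel₀ _ hn.ne']; ring
    rw [hx, e]; ring
  · have h1 : Tendsto (fun n => r n * w n) atTop (nhds 0) := by
      refine squeeze_zero_norm (a := fun n => r n * K) (fun n => ?_) (by simpa using hr0.mul_const K)
      rw [norm_mul, Real.norm_of_nonneg (hr n).1]
      exact mul_le_mul_of_nonneg_left (hw n) (hr n).1
    have h2 := h1.div hd (by positivity)
    rw [zero_div] at h2
    exact h2

lemma aux_kappa (γ : ℝ) (hγ0 : 0 < γ) (hγ : γ < 1) :
    Tendsto (fun n : ℕ => (n:ℝ)^γ * ((((n+1 : ℕ):ℝ)^γ / (n:ℝ)^γ) - 1)) atTop (nhds 0) := by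
  have h1 : Tendsto (fun n : ℕ => (n:ℝ)^(-(1 - γ))) atTop (nhds 0) :=
    (tendsto_rpow_neg_atTop (by linarith)).comp tendsto_natCast_atTop_atTop
  refine squeeze_zero' ?_ ?_ h1
  · filter_upwards [eventually_gt_atTop 0] with n h2
    have hp : 0 < (n:ℝ) := by exact_mod_cast h2
    have : (1:ℝ) ≤ ((n+1 : ℕ):ℝ)^γ / (n:ℝ)^γ := by
      rw [one_le_div (by positivity)]
      apply Real.rpow_le_rpow hp.le _ hγ0.le
      push_cast; linarith
    exact mul_nonneg (by positivity) (by linarith)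
  · filter_upwards [eventually_gt_atTop 0] with n h2
    have hp : 0 < (n:ℝ) := by exact_mod_cast h2
    have e : -(1-γ) = γ - 1 := by ring
    rw [e, Real.rpow_sub_one hp.ne', div_eq_mul_one_div ((n:ℝ)^γ)]
    gcongr
    rw [← Real.div_rpow (by positivity) hp.le]
    have h3 : ((n+1:ℕ):ℝ)/n = 1 + 1/n := by push_cast; field_simp
    rw [h3]
    have : (1 + 1/(n:ℝ))^γ ≤ (1 + 1/(n:ℝ))^(1:ℝ) :=
      Real.rpow_le_rpow_of_exponent_le (by simp) hγ.le
    rw [Real.rpow_one] at this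
    linarith

lemma aux_B (r x w : ℕ → ℝ) (α γ c W : ℝ) (hα0 : 0 < α) (hα1 : α ≤ 1) (hc : 0 < c) (hγ0 : 0 < γ) (hγ : γ < 1)
    (hr : ∀ n, 0 ≤ r n ∧ r n < 1)
    (hlim : Tendsto (fun n : ℕ => (n:ℝ)^γ * r n) atTop (nhds c))
    (hx : ∀ n, x (n+1) = ((1 - r n)^2 + 2 * r n * (1 - r n) * (1 - α)) * x n + (r n)^2 * w n)
    (hw : Tendsto w atTop (nhds W)) :
    Tendsto (fun n : ℕ => (n:ℝ)^γ * x n) atTop (nhds (c / (2 * α) * W)) := by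
  have hr0 := aux_r r γ c hγ0 hlim
  set κ : ℕ → ℝ := fun n => ((n+1 : ℕ):ℝ)^γ / (n:ℝ)^γ with hκ
  have hk := aux_kappa γ hγ0 hγ
  have hk1 : Tendsto κ atTop (nhds 1) := by
    have := (aux_r _ γ 0 hγ0 hk).add_const 1
    rw [zero_add] at this
    exact this.congr fun n => by simp only [hκ]; ring
  have hd : Tendsto (fun n => 2 * α - (2 * α - 1) * r n) atTop (nhds (2 * α)) := by
    simpa using (tendsto_const_nhds (x := 2 * α)).sub (hr0.const_mul (2*α-1))
  set a : ℕ → ℝ := fun n => 1 - κ n * ((1 - r n)^2 + 2 * r n * (1 - r n) * (1 - α)) with hadef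
  have ha : Tendsto (fun n : ℕ => (n:ℝ)^γ * a n) atTop (nhds (2*α*c)) := by
    have h := (hk1.mul (hlim.mul hd)).sub hk
    have e : 1 * (c * (2 * α)) - 0 = 2 * α * c := by ring
    rw [e] at h
    refine h.congr fun n => ?_
    simp only [hadef, hκ]; ring
  have hpos := aux_pos _ γ _ (by positivity) ha
  refine aux_tendsto _ a (fun n => κ n * ((n:ℝ)^γ * r n)^2 * w n / ((n:ℝ)^γ * a n)) _ ?_ ?_ ?_
    (aux_not_summable _ γ _ (by positivity) hγ ha)
  · filter_upwards [hpos] with n hn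
    refine ⟨hn.le, ?_⟩
    obtain ⟨h1, h2⟩ := hr n
    have h3 : 0 ≤ r n * (1 - r n) * (1 - α) :=
      mul_nonneg (mul_nonneg h1 (by linarith)) (by linarith)
    have h4 : 0 ≤ κ n := by simp only [hκ]; positivity
    have : 0 ≤ κ n * ((1 - r n)^2 + 2 * r n * (1 - r n) * (1 - α)) :=
      mul_nonneg h4 (by nlinarith [sq_nonneg (1 - r n)])
    simp only [hadef]; linarith
  · filter_upwards [hpos, eventually_gt_atTop 0] with n hn h2
    have hp : 0 < (n:ℝ) := by exact_mod_cast h2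
    have hq : 0 < (n:ℝ)^γ := by positivity
    have e1 : a n * (κ n * ((n:ℝ)^γ * r n)^2 * w n / ((n:ℝ)^γ * a n)) = κ n * (n:ℝ)^γ * (r n)^2 * w n := by
      field_simp
    have e2 : ((n+1:ℕ):ℝ)^γ = κ n * (n:ℝ)^γ := by simp only [hκ]; field_simp
    rw [e1, e2, hx]; simp only [hadef]; ring
  · have h := ((hk1.mul (hlim.pow 2)).mul hw).div ha (by positivity)
    have e : 1 * c^2 * W / (2 * α * c) = c / (2*α) * W := by field_simp
    rw [e] at h
    exact h

lemma wf_le {Ω : Type*} [m : MeasurableSpace Ω] {N : ℕ} (Z : ℕ → Fin N → Ω → ℝ)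
    (hZ : ∀ n i, Measurable (Z n i)) (n : ℕ) : walkFiltration Z n ≤ m := by
  unfold walkFiltration
  exact iSup₂_le fun k _ => iSup_le fun i => (hZ k i).comap_le

lemma wf_meas {Ω : Type*} [m : MeasurableSpace Ω] {N : ℕ} (Z : ℕ → Fin N → Ω → ℝ)
    (n : ℕ) (i : Fin N) : Measurable[walkFiltration Z n] (Z n i) := by
  rw [measurable_iff_comap_le]
  unfold walkFiltration
  refine le_trans ?_ (le_iSup₂_of_le n (by simp) (le_iSup _ i))
  exact le_rfl

lemma aux_bdd_int {Ω : Type*} [MeasurableSpace Ω] (μ : Measure Ω) [IsProbabilityMeasure μ]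
    (f : Ω → ℝ) (hf : Measurable f) (K : ℝ) (h : ∀ ω, |f ω| ≤ K) : Integrable f μ :=
  Integrable.of_bound hf.aestronglyMeasurable K (Eventually.of_forall h)

lemma aux_add3 {Ω : Type*} [MeasurableSpace Ω] (μ : Measure Ω) (f g h : Ω → ℝ)
    (h1 : Integrable f μ) (h2 : Integrable g μ) (h3 : Integrable h μ) :
    ∫ ω, (f ω + g ω + h ω) ∂μ = ∫ ω, f ω ∂μ + ∫ ω, g ω ∂μ + ∫ ω, h ω ∂μ := by
  have h12 : Integrable (fun ω => f ω + g ω) μ := h1.add h2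
  rw [integral_add h12 h3, integral_add h1 h2]

lemma aux_jensen {Ω : Type*} [MeasurableSpace Ω] (μ : Measure Ω) [IsProbabilityMeasure μ]
    (f : Ω → ℝ) (h1 : Integrable f μ) (h2 : Integrable (fun ω => f ω ^ 2) μ) :
    (∫ ω, |f ω| ∂μ)^2 ≤ ∫ ω, f ω ^ 2 ∂μ := by
  set m := ∫ ω, |f ω| ∂μ with hm
  have h : 0 ≤ ∫ ω, (|f ω| - m)^2 ∂μ := integral_nonneg fun ω => sq_nonneg _
  have e : (fun ω => (|f ω| - m)^2) = fun ω => f ω ^ 2 + (-(2 * m)) * |f ω| + m^2 := by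
    funext ω; rw [sub_sq, sq_abs]; ring
  rw [e, aux_add3 μ _ _ _ h2 (h1.abs.const_mul _) (integrable_const _),
    integral_const_mul, ← hm] at h
  simp at h
  nlinarith

/-- moment identities -/
lemma aux_moments {Ω : Type*} (m : MeasurableSpace Ω) [m0 : MeasurableSpace Ω] (μ : Measure Ω)
    [IsProbabilityMeasure μ] {N : ℕ} (hm : m ≤ m0) (J p : Fin N → Ω → ℝ) (D : Ω → ℝ)
    (hJ : ∀ i, Measurable (J i)) (hp : ∀ i, Measurable (p i)) (hD : Measurable[m] D)
    (hDb : ∀ ω, |D ω| ≤ 1) (hJ01 : ∀ i ω, J i ω = 0 ∨ J i ω = 1)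
    (hp01 : ∀ i ω, p i ω ∈ Set.Icc (0:ℝ) 1)
    (hcond : ∀ s : Finset (Fin N), μ[(fun ω => ∏ i ∈ s, J i ω) | m] =ᵐ[μ] fun ω => ∏ i ∈ s, p i ω)
    (c : Fin N → ℝ) :
    (∫ ω, D ω * ∑ j, c j * J j ω ∂μ = ∫ ω, D ω * ∑ j, c j * p j ω ∂μ) ∧
    (∫ ω, (∑ j, c j * J j ω)^2 ∂μ = ∫ ω, (∑ j, c j * p j ω)^2 ∂μ
      + ∑ j, (c j)^2 * ∫ ω, p j ω * (1 - p j ω) ∂μ) := by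
  have hD' : Measurable D := hD.mono hm le_rfl
  have hJb : ∀ i ω, |J i ω| ≤ 1 := fun i ω => by rcases hJ01 i ω with h | h <;> simp [h]
  have hpb : ∀ i ω, |p i ω| ≤ 1 := fun i ω => by
    rw [abs_of_nonneg (hp01 i ω).1]; exact (hp01 i ω).2
  have mulb : ∀ a b : ℝ, |a| ≤ 1 → |b| ≤ 1 → |a * b| ≤ 1 := fun a b h1 h2 => by
    rw [abs_mul]; exact mul_le_one₀ h1 (abs_nonneg _) h2
  have iJ : ∀ i, Integrable (J i) μ := fun i => aux_bdd_int μ _ (hJ i) 1 (hJb i)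
  have ip : ∀ i, Integrable (p i) μ := fun i => aux_bdd_int μ _ (hp i) 1 (hpb i)
  have iDJ : ∀ i, Integrable (fun ω => D ω * J i ω) μ := fun i =>
    aux_bdd_int μ _ (hD'.mul (hJ i)) 1 fun ω => mulb _ _ (hDb ω) (hJb i ω)
  have iDp : ∀ i, Integrable (fun ω => D ω * p i ω) μ := fun i =>
    aux_bdd_int μ _ (hD'.mul (hp i)) 1 fun ω => mulb _ _ (hDb ω) (hpb i ω)
  have iJJ : ∀ i j, Integrable (fun ω => J i ω * J j ω) μ := fun i j =>
    aux_bdd_int μ _ ((hJ i).mul (hJ j)) 1 fun ω => mulb _ _ (hJb i ω) (hJb j ω)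
  have ipp : ∀ i j, Integrable (fun ω => p i ω * p j ω) μ := fun i j =>
    aux_bdd_int μ _ ((hp i).mul (hp j)) 1 fun ω => mulb _ _ (hpb i ω) (hpb j ω)
  have hs : ∀ s : Finset (Fin N), ∫ ω, ∏ i ∈ s, J i ω ∂μ = ∫ ω, ∏ i ∈ s, p i ω ∂μ := fun s => by
    rw [← integral_condExp hm]; exact integral_congr_ae (hcond s)
  have hE1 : ∀ i, ∫ ω, J i ω ∂μ = ∫ ω, p i ω ∂μ := fun i => by simpa using hs {i}
  have hE2 : ∀ i j, ∫ ω, J i ω * J j ω ∂μ = ∫ ω, p i ω * p j ω ∂μ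
      + if i = j then ∫ ω, p i ω * (1 - p i ω) ∂μ else 0 := by
    intro i j
    by_cases h : i = j
    · subst h
      have e : (fun ω => J i ω * J i ω) = J i := by
        funext ω; rcases hJ01 i ω with h | h <;> simp [h]
      rw [e, hE1, if_pos rfl, ← integral_add (ipp i i)]
      · congr 1; funext ω; ring
      · refine ((ip i).sub (ipp i i)).congr (Eventually.of_forall fun ω => ?_)
        simp; ring
    · have := hs {i, j}
      simp only [Finset.prod_pair h] at this
      rw [this, if_neg h, add_zero]
  have hDJ : ∀ i, ∫ ω, D ω * J i ω ∂μ = ∫ ω, D ω * p i ω ∂μ := by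
    intro i
    rw [← integral_condExp hm]
    refine integral_congr_ae ?_
    have h1 : μ[D * J i | m] =ᵐ[μ] D * μ[J i | m] :=
      condExp_mul_of_stronglyMeasurable_left hD.stronglyMeasurable (iDJ i) (iJ i)
    have h2 : μ[J i | m] =ᵐ[μ] p i := by simpa using hcond {i}
    have h3 : (fun ω => D ω * J i ω) = D * J i := rfl
    rw [h3]
    filter_upwards [h1, h2] with ω a b
    rw [a, Pi.mul_apply, b]
  constructor
  · simp only [Finset.mul_sum]
    rw [integral_finsetSum, integral_finsetSum]
    · refine Finset.sum_congr rfl fun j _ => ?_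
      have e1 : ∀ x y : ℝ, x * (c j * y) = c j * (x * y) := fun x y => by ring
      simp only [e1]
      rw [integral_const_mul, integral_const_mul, hDJ]
    · intro j _
      have e1 : ∀ x y : ℝ, x * (c j * y) = c j * (x * y) := fun x y => by ring
      simp only [e1]
      exact (iDp j).const_mul _
    · intro j _
      have e1 : ∀ x y : ℝ, x * (c j * y) = c j * (x * y) := fun x y => by ring
      simp only [e1]
      exact (iDJ j).const_mul _
  · have key : ∀ (g : Fin N → Ω → ℝ), (∀ i j, Integrable (fun ω => g i ω * g j ω) μ) →
        ∫ ω, (∑ j, c j * g j ω)^2 ∂μ = ∑ i, ∑ j, c i * c j * ∫ ω, g i ω * g j ω ∂μ := by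
      intro g hg
      have e : ∀ ω, (∑ j, c j * g j ω)^2 = ∑ i, ∑ j, (c i * c j) * (g i ω * g j ω) := fun ω => by
        rw [sq, Finset.sum_mul_sum]
        refine Finset.sum_congr rfl fun i _ => Finset.sum_congr rfl fun j _ => by ring
      simp only [e]
      rw [integral_finsetSum _ fun i _ => integrable_finsetSum _ fun j _ => (hg i j).const_mul _]
      refine Finset.sum_congr rfl fun i _ => ?_
      rw [integral_finsetSum _ fun j _ => (hg i j).const_mul _]
      refine Finset.sum_congr rfl fun j _ => ?_
      rw [integral_const_mul]
    rw [key J iJJ, key p ipp, ← Finset.sum_add_distrib]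
    refine Finset.sum_congr rfl fun i _ => ?_
    simp only [hE2, mul_add, Finset.sum_add_distrib, mul_ite, mul_zero, Finset.sum_ite_eq,
      Finset.mem_univ, if_true, sq]

/-- **Rate of synchronization in L²**: for `ρ = 1`, `α > 0` and `n^γ r_n → c > 0` with
`1/2 < γ < 1`, `n^γ E[(Z_n(i) - Z_n)²] → (1 - 1/N)(c/(2α)) E[Z(1-Z)]`. -/
theorem stmt_11
    {Ω : Type*} [MeasurableSpace Ω] (μ : Measure Ω) [IsProbabilityMeasure μ]
    (N : ℕ) (hN : 1 ≤ N)
    (ρ α q : ℝ)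
    (hρ : ρ ∈ Set.Icc (0:ℝ) 1) (hα : α ∈ Set.Icc (0:ℝ) 1) (hq : q ∈ Set.Icc (0:ℝ) 1)
    (r : ℕ → ℝ) (hr : ∀ n, 0 ≤ r n ∧ r n < 1)
    (Z : ℕ → Fin N → Ω → ℝ) (I : ℕ → Fin N → Ω → ℝ)
    (hZmeas : ∀ n i, Measurable (Z n i))
    (hImeas : ∀ n i, Measurable (I n i))
    (hZ01 : ∀ n i ω, Z n i ω ∈ Set.Icc (0:ℝ) 1)
    (hI01 : ∀ n i ω, I n i ω = 0 ∨ I n i ω = 1)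
    -- dynamics: `Z_{n+1}(i) = (1 - r_n) Z_n(i) + r_n (ρ I_{n+1}(i) + (1-ρ) q)`
    -- (here `I n i` stands for `I_{n+1}(i)`)
    (hdyn : ∀ n i ω, Z (n + 1) i ω
      = (1 - r n) * Z n i ω + r n * (ρ * I n i ω + (1 - ρ) * q))
    -- conditional independence of `I_{n+1}(1), …, I_{n+1}(N)` given `F_n`, together with
    -- the conditional law `P(I_{n+1}(i) = 1 | F_n) = (1-α) Z_n(i) + α Z_n`, expressed
    -- (equivalently, for {0,1}-valued variables) through conditional product moments
    (hcond : ∀ n (s : Finset (Fin N)),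
      μ[(fun ω => ∏ i ∈ s, I n i ω) | walkFiltration Z n]
        =ᵐ[μ] fun ω => ∏ i ∈ s, ((1 - α) * Z n i ω + α * walkMean Z n ω))
    -- the initial configuration is permutation invariant with mean 1/2 and E[Z_0(1-Z_0)] > 0
    (hperm : ∀ σ : Equiv.Perm (Fin N),
      μ.map (fun ω (i : Fin N) => Z 0 (σ i) ω) = μ.map (fun ω (i : Fin N) => Z 0 i ω))
    (hmean0 : ∀ i, ∫ ω, Z 0 i ω ∂μ = 1 / 2)
    (hvar0 : 0 < ∫ ω, walkMean Z 0 ω * (1 - walkMean Z 0 ω) ∂μ)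
    (hρ1 : ρ = 1) (hα0 : 0 < α)
    (c γ : ℝ) (hc : 0 < c) (hγ : 1/2 < γ ∧ γ < 1)
    (hlim : Tendsto (fun n : ℕ => (n : ℝ) ^ γ * r n) atTop (nhds c))
    (Zlim : Ω → ℝ) (hZlimMeas : Measurable Zlim)
    (hZlim : ∀ᵐ ω ∂μ, Tendsto (fun n => walkMean Z n ω) atTop (nhds (Zlim ω))) :
    ∀ i : Fin N, Tendsto
      (fun n : ℕ => (n : ℝ) ^ γ * ∫ ω, (Z n i ω - walkMean Z n ω) ^ 2 ∂μ)
      atTop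
      (nhds ((1 - 1 / N) * (c / (2 * α)) * ∫ ω, Zlim ω * (1 - Zlim ω) ∂μ)) := by
  
  subst hρ1
  have hN0 : (0:ℝ) < N := by exact_mod_cast hN
  have hγ0 : 0 < γ := by linarith [hγ.1]
  have hM : ∀ n, Measurable (walkMean Z n) := fun n =>
    (Finset.measurable_sum _ fun i _ => hZmeas n i).div_const _
  have hM01 : ∀ n ω, walkMean Z n ω ∈ Set.Icc (0:ℝ) 1 := by
    intro n ω
    unfold walkMean
    constructor
    · exact div_nonneg (Finset.sum_nonneg fun i _ => (hZ01 n i ω).1) hN0.le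
    · rw [div_le_one hN0]
      calc ∑ i : Fin N, Z n i ω ≤ ∑ i : Fin N, (1:ℝ) := Finset.sum_le_sum fun i _ => (hZ01 n i ω).2
        _ = N := by simp
  set D : ℕ → Fin N → Ω → ℝ := fun n i ω => Z n i ω - walkMean Z n ω with hDdef
  set p : ℕ → Fin N → Ω → ℝ := fun n i ω => (1 - α) * Z n i ω + α * walkMean Z n ω with hpdef
  have hDm : ∀ n i, Measurable (D n i) := fun n i => (hZmeas n i).sub (hM n)
  have hDb : ∀ n i ω, |D n i ω| ≤ 1 := fun n i ω => by
    have h1 := hZ01 n i ω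
    have h2 := hM01 n ω
    rw [abs_le]; simp only [hDdef]; constructor <;> linarith [h1.1, h1.2, h2.1, h2.2]
  have hDF : ∀ n i, Measurable[walkFiltration Z n] (D n i) := by
    intro n i
    refine Measurable.sub (wf_meas Z n i) ?_
    exact (Finset.measurable_sum _ fun i _ => wf_meas Z n i).div_const _
  have hpm : ∀ n i, Measurable (p n i) := fun n i =>
    ((hZmeas n i).const_mul _).add ((hM n).const_mul _)
  have hp01 : ∀ n i ω, p n i ω ∈ Set.Icc (0:ℝ) 1 := fun n i ω => by
    have h1 := hZ01 n i ω
    have h2 := hM01 n ω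
    simp only [hpdef]
    constructor
    · exact add_nonneg (mul_nonneg (by linarith [hα.2]) h1.1) (mul_nonneg hα.1 h2.1)
    · nlinarith [h1.2, h2.2, hα.1, hα.2]
  have iD : ∀ n i, Integrable (D n i) μ := fun n i => aux_bdd_int μ _ (hDm n i) 1 (hDb n i)
  have iD2 : ∀ n i, Integrable (fun ω => D n i ω ^ 2) μ := fun n i =>
    aux_bdd_int μ _ ((hDm n i).pow_const 2) 1 fun ω => by
      rw [abs_pow]; exact pow_le_one₀ (abs_nonneg _) (hDb n i ω)
  -- coefficients
  set C : Fin N → Fin N → ℝ := fun i j => (if j = i then 1 else 0) - 1 / N with hC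
  have hCsum : ∀ i (f : Fin N → ℝ), ∑ j, C i j * f j = f i - (∑ j, f j) / N := by
    intro i f
    simp only [hC, sub_mul, Finset.sum_sub_distrib, ite_mul, one_mul, zero_mul, Finset.sum_ite_eq',
      Finset.mem_univ, if_true]
    rw [← Finset.mul_sum]; ring
  have hC2 : ∀ i, ∑ j, (C i j)^2 = 1 - 1 / N := by
    intro i
    have h := hCsum i (C i)
    have h' := hCsum i (fun _ => 1)
    simp only [mul_one, Finset.sum_const, Finset.card_univ, Fintype.card_fin, nsmul_eq_mul,
      div_self hN0.ne', sub_self] at h'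
    simp only [sq]
    rw [h, h']; simp [hC]
  have hCp : ∀ n i ω, ∑ j, C i j * p n j ω = (1 - α) * D n i ω := by
    intro n i ω
    rw [hCsum]
    simp only [hpdef, hDdef, Finset.sum_add_distrib, ← Finset.mul_sum, Finset.sum_const,
      Finset.card_univ, Fintype.card_fin, nsmul_eq_mul]
    have : ∑ i, Z n i ω = N * walkMean Z n ω := by unfold walkMean; field_simp
    rw [this]; field_simp; ring
  have hDrec : ∀ n i ω, D (n+1) i ω = (1 - r n) * D n i ω + r n * ∑ j, C i j * I n j ω := by
    intro n i ω
    rw [hCsum]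
    simp only [hDdef, walkMean, hdyn, Finset.sum_add_distrib, ← Finset.mul_sum, sub_self, zero_mul,
      add_zero, one_mul]
    ring
  set x : Fin N → ℕ → ℝ := fun i n => ∫ ω, D n i ω ^ 2 ∂μ with hxdef
  set w : Fin N → ℕ → ℝ := fun i n => ∫ ω, (∑ j, C i j * I n j ω)^2 ∂μ with hwdef
  have hmom := fun n i => aux_moments (walkFiltration Z n) μ (wf_le Z hZmeas n) (I n) (p n) (D n i)
    (hImeas n) (hpm n) (hDF n i) (hDb n i) (hI01 n) (hp01 n) (hcond n) (C i)
  have hSb : ∀ n i ω, |∑ j, C i j * I n j ω| ≤ ∑ j, |C i j| := by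
    intro n i ω
    refine (Finset.abs_sum_le_sum_abs _ _).trans (Finset.sum_le_sum fun j _ => ?_)
    rcases hI01 n j ω with h | h <;> simp [h]
  have hSm : ∀ n i, Measurable (fun ω => ∑ j, C i j * I n j ω) := fun n i =>
    Finset.measurable_sum _ fun j _ => (hImeas n j).const_mul _
  have iS2 : ∀ n i, Integrable (fun ω => (∑ j, C i j * I n j ω)^2) μ := fun n i =>
    aux_bdd_int μ _ ((hSm n i).pow_const 2) ((∑ j, |C i j|)^2) fun ω => by
      rw [abs_pow]; exact pow_le_pow_left₀ (abs_nonneg _) (hSb n i ω) 2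
  have iDS : ∀ n i, Integrable (fun ω => D n i ω * ∑ j, C i j * I n j ω) μ := fun n i =>
    aux_bdd_int μ _ ((hDm n i).mul (hSm n i)) (1 * ∑ j, |C i j|) fun ω => by
      rw [abs_mul]; exact mul_le_mul (hDb n i ω) (hSb n i ω) (abs_nonneg _) zero_le_one
  have hxrec : ∀ i n, x i (n+1)
      = ((1 - r n)^2 + 2 * r n * (1 - r n) * (1 - α)) * x i n + (r n)^2 * w i n := by
    intro i n
    have e : ∀ ω, D (n+1) i ω ^ 2 = (1 - r n)^2 * D n i ω ^ 2
        + 2 * r n * (1 - r n) * (D n i ω * ∑ j, C i j * I n j ω)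
        + (r n)^2 * (∑ j, C i j * I n j ω)^2 := fun ω => by rw [hDrec]; ring
    have e2 : ∫ ω, D n i ω * ∑ j, C i j * I n j ω ∂μ = (1 - α) * x i n := by
      rw [(hmom n i).1]
      simp only [hCp, hxdef]
      rw [← integral_const_mul]
      congr 1; funext ω; ring
    have h1 := (iD2 n i).const_mul ((1 - r n)^2)
    have h2 := (iDS n i).const_mul (2 * r n * (1 - r n))
    have h3 := (iS2 n i).const_mul ((r n)^2)
    have : x i (n+1) = ∫ ω, ((1 - r n)^2 * D n i ω ^ 2
        + 2 * r n * (1 - r n) * (D n i ω * ∑ j, C i j * I n j ω)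
        + (r n)^2 * (∑ j, C i j * I n j ω)^2) ∂μ := by
      simp only [hxdef, e]
    rw [this, aux_add3 μ _ _ _ h1 h2 h3, integral_const_mul,
      integral_const_mul, integral_const_mul, e2]
    simp only [hxdef, hwdef]; ring
  have hwb : ∀ i n, |w i n| ≤ (∑ j, |C i j|)^2 := by
    intro i n
    have := norm_integral_le_of_norm_le_const (μ := μ) (f := fun ω => (∑ j, C i j * I n j ω)^2)
      (C := (∑ j, |C i j|)^2) (Eventually.of_forall fun ω => by
        rw [norm_pow]; exact pow_le_pow_left₀ (abs_nonneg _) (hSb n i ω) 2)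
    simpa using this
  have hx0 : ∀ i, Tendsto (x i) atTop (nhds 0) := fun i =>
    aux_A r (x i) (w i) α γ c _ hα0 hα.2 hc hγ0 hγ.2 hr hlim (hxrec i) (hwb i)
  have hmean : Tendsto (fun n => ∫ ω, walkMean Z n ω * (1 - walkMean Z n ω) ∂μ) atTop
      (nhds (∫ ω, Zlim ω * (1 - Zlim ω) ∂μ)) := by
    refine tendsto_integral_of_dominated_convergence (fun _ => 1)
      (fun n => ((hM n).mul ((hM n).const_sub 1)).aestronglyMeasurable) (integrable_const _) ?_ ?_
    · intro n
      refine Eventually.of_forall fun ω => ?_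
      have h := hM01 n ω
      rw [Real.norm_of_nonneg (mul_nonneg h.1 (by linarith [h.2]))]
      nlinarith [h.1, h.2]
    · filter_upwards [hZlim] with ω h
      exact h.mul (h.const_sub 1)
  have hpp : ∀ j, Tendsto (fun n => ∫ ω, p n j ω * (1 - p n j ω) ∂μ) atTop
      (nhds (∫ ω, Zlim ω * (1 - Zlim ω) ∂μ)) := by
    intro j
    have hdiff : Tendsto (fun n => ∫ ω, p n j ω * (1 - p n j ω) ∂μ
        - ∫ ω, walkMean Z n ω * (1 - walkMean Z n ω) ∂μ) atTop (nhds 0) := by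
      have hsq : Tendsto (fun n => Real.sqrt (x j n)) atTop (nhds 0) := by
        have := (Real.continuous_sqrt.tendsto 0).comp (hx0 j)
        rwa [Real.sqrt_zero] at this
      refine squeeze_zero_norm (fun n => ?_) hsq
      have i1 : Integrable (fun ω => p n j ω * (1 - p n j ω)) μ :=
        aux_bdd_int μ _ ((hpm n j).mul ((hpm n j).const_sub 1)) 1 fun ω => by
          have h := hp01 n j ω
          rw [abs_of_nonneg (mul_nonneg h.1 (by linarith [h.2]))]
          nlinarith [h.1, h.2]
      have i2 : Integrable (fun ω => walkMean Z n ω * (1 - walkMean Z n ω)) μ :=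
        aux_bdd_int μ _ ((hM n).mul ((hM n).const_sub 1)) 1 fun ω => by
          have h := hM01 n ω
          rw [abs_of_nonneg (mul_nonneg h.1 (by linarith [h.2]))]
          nlinarith [h.1, h.2]
      rw [← integral_sub i1 i2]
      have hle : ‖∫ ω, (p n j ω * (1 - p n j ω) - walkMean Z n ω * (1 - walkMean Z n ω)) ∂μ‖
          ≤ ∫ ω, |D n j ω| ∂μ := by
        refine norm_integral_le_of_norm_le (iD n j).abs (Eventually.of_forall fun ω => ?_)
        have e : p n j ω * (1 - p n j ω) - walkMean Z n ω * (1 - walkMean Z n ω)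
            = D n j ω * ((1 - α) * (1 - p n j ω - walkMean Z n ω)) := by
          simp only [hpdef, hDdef]; ring
        rw [e, norm_mul, Real.norm_eq_abs]
        refine mul_le_of_le_one_right (abs_nonneg _) ?_
        rw [norm_mul, Real.norm_of_nonneg (by linarith [hα.2] : 0 ≤ 1 - α), Real.norm_eq_abs]
        have h := hM01 n ω
        have h' := hp01 n j ω
        refine mul_le_one₀ (by linarith) (abs_nonneg _) ?_
        rw [abs_le]; constructor <;> linarith [h.1, h.2, h'.1, h'.2]
      exact hle.trans (Real.le_sqrt_of_sq_le (aux_jensen μ _ (iD n j) (iD2 n j)))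
    have := hdiff.add hmean
    rw [zero_add] at this
    exact this.congr fun n => by ring
  intro i
  have hw : Tendsto (w i) atTop (nhds ((1 - 1 / N) * ∫ ω, Zlim ω * (1 - Zlim ω) ∂μ)) := by
    have h1 : ∀ n, w i n = (1 - α)^2 * x i n
        + ∑ j, (C i j)^2 * ∫ ω, p n j ω * (1 - p n j ω) ∂μ := by
      intro n
      simp only [hwdef]
      rw [(hmom n i).2]
      simp only [hCp, mul_pow, hxdef]
      rw [integral_const_mul]
    have h2 := ((hx0 i).const_mul ((1-α)^2)).add
      (tendsto_finsetSum Finset.univ fun j _ => (hpp j).const_mul ((C i j)^2))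
    rw [mul_zero, zero_add, ← Finset.sum_mul, hC2] at h2
    exact h2.congr fun n => (h1 n).symm
  have := aux_B r (x i) (w i) α γ c _ hα0 hα.2 hc hγ0 hγ.2 hr hlim (hxrec i) hw
  have e : (1 - 1 / (N:ℝ)) * (c / (2 * α)) * ∫ ω, Zlim ω * (1 - Zlim ω) ∂μ
      = c / (2 * α) * ((1 - 1 / N) * ∫ ω, Zlim ω * (1 - Zlim ω) ∂μ) := by ring
  rw [e]
  exact this
end
end

section
/- Suppose ρ = 1 and α ∈ [0,1]. Set x_n := 1/4 − Var(Z_n) and C := (1 − (1 − α)²)/N. Then, for every n ≥ 0, x_n ≥ 0 and x_{n+1} ≤ (1 − C r_n²) x_n; consequently x_n ≤ x_0 ∏_{k=0}^{n−1} (1 − C r_k²), so that if α > 0 and Σ_n r_n² = +∞, then x_n → 0, i.e. Var(Z_n) → 1/4. -/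
open MeasureTheory Filter Real

noncomputable section

lemma walkMean_mem {Ω : Type*} {N : ℕ} (hN : 1 ≤ N) (Z : ℕ → Fin N → Ω → ℝ)
    (hZ01 : ∀ n i ω, Z n i ω ∈ Set.Icc (0:ℝ) 1) (n : ℕ) (ω : Ω) :
    walkMean Z n ω ∈ Set.Icc (0:ℝ) 1 := by
  have hN' : (0:ℝ) < N := by exact_mod_cast hN
  unfold walkMean
  constructor
  · exact div_nonneg (Finset.sum_nonneg fun i _ => (hZ01 n i ω).1) hN'.le
  · rw [div_le_one hN']
    calc ∑ i : Fin N, Z n i ω ≤ ∑ i : Fin N, (1:ℝ) := Finset.sum_le_sum fun i _ => (hZ01 n i ω).2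
      _ = N := by simp

lemma sum_p_ge {N : ℕ} (hN : 1 ≤ N) (α : ℝ) (z : Fin N → ℝ)
    (hz : ∀ i, z i ∈ Set.Icc (0:ℝ) 1) (m : ℝ) (hm : m = (∑ i, z i) / N) :
    N * (1 - (1 - α) ^ 2) * (m * (1 - m)) ≤
      ∑ i, (((1 - α) * z i + α * m) - ((1 - α) * z i + α * m) ^ 2) := by
  have hN' : (0:ℝ) < N := by exact_mod_cast hN
  have hs : ∑ i, z i = N * m := by rw [hm]; field_simp
  have hq : ∑ i, z i ^ 2 ≤ N * m := by
    rw [← hs]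
    exact Finset.sum_le_sum fun i _ => by nlinarith [(hz i).1, (hz i).2]
  have e : ∑ i, (((1 - α) * z i + α * m) - ((1 - α) * z i + α * m) ^ 2)
      = ((1 - α) - 2 * (1 - α) * α * m) * ∑ i, z i - (1 - α) ^ 2 * ∑ i, z i ^ 2
        + N * (α * m - α ^ 2 * m ^ 2) := by
    rw [Finset.mul_sum, Finset.mul_sum, ← Finset.sum_sub_distrib]
    have : (N:ℝ) * (α * m - α ^ 2 * m ^ 2) = ∑ i : Fin N, (α * m - α ^ 2 * m ^ 2) := by simp; ring
    rw [this, ← Finset.sum_add_distrib]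
    exact Finset.sum_congr rfl fun i _ => by ring
  rw [e, hs]
  nlinarith [mul_le_mul_of_nonneg_left hq (sq_nonneg (1 - α))]

lemma integrable_of_bdd {Ω : Type*} [MeasurableSpace Ω] (μ : Measure Ω) [IsProbabilityMeasure μ]
    (f : Ω → ℝ) (hf : Measurable f) (h : ∀ ω, f ω ∈ Set.Icc (0:ℝ) 1) : Integrable f μ :=
  Integrable.of_bound hf.aestronglyMeasurable 1 (ae_of_all _ fun ω => by
    rw [Real.norm_eq_abs, abs_le]; constructor <;> linarith [(h ω).1, (h ω).2])

lemma pull {Ω : Type*} (m : MeasurableSpace Ω) [m0 : MeasurableSpace Ω] (μ : Measure Ω)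
    [IsProbabilityMeasure μ] (hm : m ≤ m0) (g f p : Ω → ℝ) (hg : Measurable[m] g)
    (hg1 : ∀ ω, g ω ∈ Set.Icc (0:ℝ) 1) (hf : Measurable f) (hf1 : ∀ ω, f ω ∈ Set.Icc (0:ℝ) 1)
    (h : μ[f | m] =ᵐ[μ] p) : ∫ ω, g ω * f ω ∂μ = ∫ ω, g ω * p ω ∂μ := by
  have hfi := integrable_of_bdd μ f hf hf1
  have hgf : Integrable (g * f) μ := integrable_of_bdd μ _ ((hg.mono hm le_rfl).mul hf)
    fun ω => ⟨mul_nonneg (hg1 ω).1 (hf1 ω).1, mul_le_one₀ (hg1 ω).2 (hf1 ω).1 (hf1 ω).2⟩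
  have := condExp_mul_of_stronglyMeasurable_left (μ := μ) hg.stronglyMeasurable hgf hfi
  calc ∫ ω, g ω * f ω ∂μ = ∫ ω, (μ[g * f | m]) ω ∂μ := (integral_condExp hm).symm
    _ = ∫ ω, g ω * p ω ∂μ := by
      apply integral_congr_ae
      filter_upwards [this, h] with ω h1 h2
      rw [h1, Pi.mul_apply, h2]

/-- one step -/
lemma step {Ω : Type*} [MeasurableSpace Ω] (μ : Measure Ω) [IsProbabilityMeasure μ]
    (N : ℕ) (hN : 1 ≤ N) (r : ℝ) (M M' : Ω → ℝ) (I p : Fin N → Ω → ℝ)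
    (hM : Measurable M) (hM1 : ∀ ω, M ω ∈ Set.Icc (0:ℝ) 1)
    (hI : ∀ i, Measurable (I i)) (hI1 : ∀ i ω, I i ω ∈ Set.Icc (0:ℝ) 1)
    (hI2 : ∀ i ω, I i ω * I i ω = I i ω)
    (hp : ∀ i, Measurable (p i)) (hp1 : ∀ i ω, p i ω ∈ Set.Icc (0:ℝ) 1)
    (hpM : ∀ ω, ∑ i, p i ω = N * M ω)
    (hM' : ∀ ω, M' ω = (1 - r) * M ω + r * ((∑ i, I i ω) / N))
    (h1 : ∀ i, ∫ ω, I i ω ∂μ = ∫ ω, p i ω ∂μ)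
    (h2 : ∀ i, ∫ ω, M ω * I i ω ∂μ = ∫ ω, M ω * p i ω ∂μ)
    (h3 : ∀ i j, i ≠ j → ∫ ω, I i ω * I j ω ∂μ = ∫ ω, p i ω * p j ω ∂μ) :
    ∫ ω, M' ω ∂μ = ∫ ω, M ω ∂μ ∧
    ∫ ω, M' ω ^ 2 ∂μ = ∫ ω, M ω ^ 2 ∂μ + (r / N) ^ 2 * ∫ ω, ∑ i, (p i ω - p i ω ^ 2) ∂μ := by
  have hN' : (N:ℝ) ≠ 0 := by positivity
  have mulI : ∀ f g : Ω → ℝ, Measurable f → Measurable g → (∀ ω, f ω ∈ Set.Icc (0:ℝ) 1) →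
      (∀ ω, g ω ∈ Set.Icc (0:ℝ) 1) → Integrable (fun ω => f ω * g ω) μ := fun f g hf hg hf1 hg1 =>
    integrable_of_bdd μ _ (hf.mul hg)
      fun ω => ⟨mul_nonneg (hf1 ω).1 (hg1 ω).1, mul_le_one₀ (hf1 ω).2 (hg1 ω).1 (hg1 ω).2⟩
  have iM := integrable_of_bdd μ M hM hM1
  have iI := fun i => integrable_of_bdd μ _ (hI i) (hI1 i)
  have ip := fun i => integrable_of_bdd μ _ (hp i) (hp1 i)
  have iMM := mulI M M hM hM hM1 hM1
  have iMI := fun i => mulI M (I i) hM (hI i) hM1 (hI1 i)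
  have iMp := fun i => mulI M (p i) hM (hp i) hM1 (hp1 i)
  have iII := fun i j => mulI (I i) (I j) (hI i) (hI j) (hI1 i) (hI1 j)
  have ipp := fun i j => mulI (p i) (p j) (hp i) (hp j) (hp1 i) (hp1 j)
  have sI : ∫ ω, ∑ i, I i ω ∂μ = N * ∫ ω, M ω ∂μ := by
    rw [integral_finsetSum _ fun i _ => iI i, ← integral_const_mul]
    simp_rw [h1, ← hpM]
    rw [integral_finsetSum _ fun i _ => ip i]
  have sMI : ∫ ω, ∑ i, M ω * I i ω ∂μ = N * ∫ ω, M ω * M ω ∂μ := by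
    rw [integral_finsetSum _ fun i _ => iMI i, ← integral_const_mul]
    simp_rw [h2]
    rw [← integral_finsetSum _ fun i _ => iMp i]
    congr 1; ext ω
    rw [← Finset.mul_sum, hpM]; ring
  have ipq : ∀ i, Integrable (fun ω => p i ω - p i ω ^ 2) μ := fun i => by
    simp_rw [pow_two]
    exact (ip i).sub (ipp i i)
  have sII : ∫ ω, ∑ i, ∑ j, I i ω * I j ω ∂μ
      = N ^ 2 * ∫ ω, M ω * M ω ∂μ + ∫ ω, ∑ i, (p i ω - p i ω ^ 2) ∂μ := by
    have e : ∀ i j, ∫ ω, I i ω * I j ω ∂μ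
        = ∫ ω, p i ω * p j ω ∂μ + if i = j then ∫ ω, (p i ω - p i ω ^ 2) ∂μ else 0 := by
      intro i j
      split_ifs with hij
      · subst hij
        rw [← integral_add (ipp i i) (ipq i)]
        simp_rw [hI2, h1]
        congr 1; ext ω; ring
      · rw [h3 i j hij, add_zero]
    rw [integral_finsetSum _ fun i _ => integrable_finsetSum _ fun j _ => iII i j]
    simp_rw [integral_finsetSum _ fun j _ => iII _ j, e, Finset.sum_add_distrib]
    rw [integral_finsetSum _ fun i _ => ipq i]
    congr 1
    · simp_rw [← integral_finsetSum _ fun j _ => ipp _ j]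
      rw [← integral_finsetSum _ fun i _ => integrable_finsetSum _ fun j _ => ipp i j,
        ← integral_const_mul]
      congr 1; ext ω
      rw [← Finset.sum_mul_sum, hpM]; ring
    · simp
  have iS := integrable_finsetSum Finset.univ fun i _ => iI i
  have iMS := integrable_finsetSum Finset.univ fun i _ => iMI i
  have iSS := integrable_finsetSum Finset.univ fun i _ =>
    integrable_finsetSum Finset.univ fun j _ => iII i j
  constructor
  · have : ∀ ω, M' ω = (1 - r) * M ω + (r / N) * ∑ i, I i ω := fun ω => by rw [hM']; ring
    simp_rw [this]
    rw [integral_add (iM.const_mul _) (iS.const_mul _), integral_const_mul, integral_const_mul, sI]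
    field_simp; ring
  · have : ∀ ω, M' ω ^ 2 = ((1 - r) ^ 2 * (M ω * M ω) + (2 * (1 - r) * r / N) * ∑ i, M ω * I i ω)
        + (r / N) ^ 2 * ∑ i, ∑ j, I i ω * I j ω := fun ω => by
      rw [hM', ← Finset.mul_sum, ← Finset.sum_mul_sum]; ring
    simp_rw [this]
    have iA : Integrable (fun ω => (1 - r) ^ 2 * (M ω * M ω)
        + (2 * (1 - r) * r / N) * ∑ i, M ω * I i ω) μ := (iMM.const_mul _).add (iMS.const_mul _)
    rw [integral_add iA (iSS.const_mul _),
      integral_add (iMM.const_mul _) (iMS.const_mul _),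
      integral_const_mul, integral_const_mul, integral_const_mul, sMI, sII]
    simp_rw [pow_two (M _)]
    field_simp; ring

/-- **Variance recursion (lower bound for polarization)**: for `ρ = 1`, setting
`x_n := 1/4 - Var(Z_n)` and `C := (1 - (1-α)²)/N`, one has `x_n ≥ 0`,
`x_{n+1} ≤ (1 - C r_n²) x_n`, hence `x_n ≤ x_0 ∏_{k<n} (1 - C r_k²)`; so if `α > 0`
and `Σ r_n² = +∞` then `x_n → 0`, i.e. `Var(Z_n) → 1/4`. -/
theorem stmt_13
    {Ω : Type*} [MeasurableSpace Ω] (μ : Measure Ω) [IsProbabilityMeasure μ]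
    (N : ℕ) (hN : 1 ≤ N)
    (ρ α q : ℝ)
    (hρ : ρ ∈ Set.Icc (0:ℝ) 1) (hα : α ∈ Set.Icc (0:ℝ) 1) (hq : q ∈ Set.Icc (0:ℝ) 1)
    (r : ℕ → ℝ) (hr : ∀ n, 0 ≤ r n ∧ r n < 1)
    (Z : ℕ → Fin N → Ω → ℝ) (I : ℕ → Fin N → Ω → ℝ)
    (hZmeas : ∀ n i, Measurable (Z n i))
    (hImeas : ∀ n i, Measurable (I n i))
    (hZ01 : ∀ n i ω, Z n i ω ∈ Set.Icc (0:ℝ) 1)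
    (hI01 : ∀ n i ω, I n i ω = 0 ∨ I n i ω = 1)
    -- dynamics: `Z_{n+1}(i) = (1 - r_n) Z_n(i) + r_n (ρ I_{n+1}(i) + (1-ρ) q)`
    -- (here `I n i` stands for `I_{n+1}(i)`)
    (hdyn : ∀ n i ω, Z (n + 1) i ω
      = (1 - r n) * Z n i ω + r n * (ρ * I n i ω + (1 - ρ) * q))
    -- conditional independence of `I_{n+1}(1), …, I_{n+1}(N)` given `F_n`, together with
    -- the conditional law `P(I_{n+1}(i) = 1 | F_n) = (1-α) Z_n(i) + α Z_n`, expressed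
    -- (equivalently, for {0,1}-valued variables) through conditional product moments
    (hcond : ∀ n (s : Finset (Fin N)),
      μ[(fun ω => ∏ i ∈ s, I n i ω) | walkFiltration Z n]
        =ᵐ[μ] fun ω => ∏ i ∈ s, ((1 - α) * Z n i ω + α * walkMean Z n ω))
    -- the initial configuration is permutation invariant with mean 1/2 and E[Z_0(1-Z_0)] > 0
    (hperm : ∀ σ : Equiv.Perm (Fin N),
      μ.map (fun ω (i : Fin N) => Z 0 (σ i) ω) = μ.map (fun ω (i : Fin N) => Z 0 i ω))
    (hmean0 : ∀ i, ∫ ω, Z 0 i ω ∂μ = 1 / 2)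
    (hvar0 : 0 < ∫ ω, walkMean Z 0 ω * (1 - walkMean Z 0 ω) ∂μ)
    (hρ1 : ρ = 1)
    (x : ℕ → ℝ)
    (hx : ∀ n, x n = 1 / 4 - ProbabilityTheory.variance (fun ω => walkMean Z n ω) μ)
    (C : ℝ) (hC : C = (1 - (1 - α) ^ 2) / N) :
    (∀ n, 0 ≤ x n ∧ x (n + 1) ≤ (1 - C * (r n) ^ 2) * x n)
    ∧ (∀ n, x n ≤ x 0 * ∏ k ∈ Finset.range n, (1 - C * (r k) ^ 2))
    ∧ (0 < α → ¬ Summable (fun n => (r n) ^ 2) → Tendsto x atTop (nhds 0)) := by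
  subst hρ1
  have hN' : (0:ℝ) < N := by exact_mod_cast hN
  have hN1 : (1:ℝ) ≤ N := by exact_mod_cast hN
  obtain ⟨hα0, hα1⟩ := hα
  have hMm : ∀ n, Measurable (walkMean Z n) := fun n => by
    unfold walkMean
    exact (Finset.measurable_sum _ fun i _ => hZmeas n i).div_const _
  have hM1 := walkMean_mem hN Z hZ01
  have hle : ∀ n, walkFiltration Z n ≤ (inferInstance : MeasurableSpace Ω) := fun n => by
    unfold walkFiltration
    refine iSup₂_le fun k _ => iSup_le fun i => ?_
    rw [← BorelSpace.measurable_eq (α := ℝ)]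
    exact (hZmeas k i).comap_le
  have hZF : ∀ n i, Measurable[walkFiltration Z n] (Z n i) := fun n i => by
    rw [measurable_iff_comap_le, BorelSpace.measurable_eq (α := ℝ)]
    unfold walkFiltration
    exact le_trans (le_iSup (fun i => MeasurableSpace.comap (Z n i) (borel ℝ)) i)
      (le_iSup₂ (f := fun k (_ : k ∈ Finset.range (n + 1)) =>
        ⨆ i : Fin N, MeasurableSpace.comap (Z k i) (borel ℝ)) n (by simp))
  have hMF : ∀ n, Measurable[walkFiltration Z n] (walkMean Z n) := fun n => by
    unfold walkMean
    exact (Finset.measurable_sum _ fun i _ => hZF n i).div_const _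
  have hsum : ∀ n ω, ∑ i, Z n i ω = N * walkMean Z n ω := fun n ω => by
    unfold walkMean; field_simp
  have hI1 : ∀ n i ω, I n i ω ∈ Set.Icc (0:ℝ) 1 := fun n i ω => by
    rcases hI01 n i ω with h | h <;> rw [h] <;> simp
  have key : ∀ n, _ ∧ _ := fun n =>
    step μ N hN (r n) (walkMean Z n) (walkMean Z (n + 1)) (I n)
      (fun i ω => (1 - α) * Z n i ω + α * walkMean Z n ω) (hMm n) (hM1 n) (hImeas n) (hI1 n)
      (fun i ω => by rcases hI01 n i ω with h | h <;> rw [h] <;> simp)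
      (fun i => ((hZmeas n i).const_mul _).add ((hMm n).const_mul _))
      (fun i ω => by
        have a := hZ01 n i ω
        have b := hM1 n ω
        constructor
        · have := mul_nonneg (sub_nonneg.2 hα1) a.1
          have := mul_nonneg hα0 b.1
          linarith
        · have := mul_le_mul_of_nonneg_left a.2 (sub_nonneg.2 hα1)
          have := mul_le_mul_of_nonneg_left b.2 hα0
          linarith)
      (fun ω => by
        rw [Finset.sum_add_distrib, ← Finset.mul_sum, hsum]
        simp; ring)
      (fun ω => by
        have : ∑ i, Z (n + 1) i ω = (1 - r n) * ∑ i, Z n i ω + r n * ∑ i, I n i ω := by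
          rw [Finset.mul_sum, Finset.mul_sum, ← Finset.sum_add_distrib]
          exact Finset.sum_congr rfl fun i _ => by rw [hdyn]; ring
        unfold walkMean
        rw [this]; ring)
      (fun i => by
        have h := hcond n {i}
        simp only [Finset.prod_singleton] at h
        have := pull _ μ (hle n) (fun _ => 1) _ _ measurable_const (fun _ => by simp)
          (hImeas n i) (hI1 n i) h
        simpa using this)
      (fun i => by
        have h := hcond n {i}
        simp only [Finset.prod_singleton] at h
        exact pull _ μ (hle n) _ _ _ (hMF n) (hM1 n) (hImeas n i) (hI1 n i) h)
      (fun i j hij => by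
        have h := hcond n {i, j}
        simp only [Finset.prod_pair hij] at h
        have := pull _ μ (hle n) (fun _ => 1) _ _ measurable_const (fun _ => by simp)
          ((hImeas n i).mul (hImeas n j))
          (fun ω => ⟨mul_nonneg (hI1 n i ω).1 (hI1 n j ω).1,
            mul_le_one₀ (hI1 n i ω).2 (hI1 n j ω).1 (hI1 n j ω).2⟩) h
        simpa using this)
  have hmean : ∀ n, ∫ ω, walkMean Z n ω ∂μ = 1 / 2 := by
    intro n
    induction n with
    | zero =>
      unfold walkMean
      rw [integral_div, integral_finsetSum _ fun i _ =>
        integrable_of_bdd μ _ (hZmeas 0 i) (hZ01 0 i)]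
      simp_rw [hmean0]
      simp; field_simp
    | succ n ih => rw [(key n).1, ih]
  have iM := fun n => integrable_of_bdd μ _ (hMm n) (hM1 n)
  have iM2 : ∀ n, Integrable (fun ω => walkMean Z n ω ^ 2) μ := fun n =>
    integrable_of_bdd μ _ ((hMm n).pow_const 2)
      fun ω => ⟨sq_nonneg _, pow_le_one₀ (hM1 n ω).1 (hM1 n ω).2⟩
  have hx' : ∀ n, x n = 1 / 2 - ∫ ω, walkMean Z n ω ^ 2 ∂μ := fun n => by
    have hL : MemLp (fun ω => walkMean Z n ω) 2 μ :=
      (memLp_two_iff_integrable_sq (hMm n).aestronglyMeasurable).2 (iM2 n)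
    rw [hx, ProbabilityTheory.variance_eq_sub hL, hmean]
    simp only [Pi.pow_apply]
    ring
  have hx'' : ∀ n, x n = ∫ ω, walkMean Z n ω * (1 - walkMean Z n ω) ∂μ := fun n => by
    rw [hx', ← hmean n, ← integral_sub (iM n) (iM2 n)]
    congr 1; ext ω; ring
  have hx0 : ∀ n, 0 ≤ x n := fun n => by
    rw [hx'']
    exact integral_nonneg fun ω => mul_nonneg (hM1 n ω).1 (sub_nonneg.2 (hM1 n ω).2)
  have hstep : ∀ n, x (n + 1) ≤ (1 - C * (r n) ^ 2) * x n := fun n => by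
    have hge : N * (1 - (1 - α) ^ 2) * x n ≤ ∫ ω, ∑ i, (((1 - α) * Z n i ω + α * walkMean Z n ω)
        - ((1 - α) * Z n i ω + α * walkMean Z n ω) ^ 2) ∂μ := by
      rw [hx'', ← integral_const_mul]
      apply integral_mono
      · have : Integrable (fun ω => walkMean Z n ω * (1 - walkMean Z n ω)) μ := by
          convert (iM n).sub (iM2 n) using 1
          ext ω; simp; ring
        exact this.const_mul _
      · refine integrable_finsetSum _ fun i _ => ?_
        have mp : Measurable fun ω => (1 - α) * Z n i ω + α * walkMean Z n ω :=
          ((hZmeas n i).const_mul _).add ((hMm n).const_mul _)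
        refine integrable_of_bdd μ _ (mp.sub (mp.pow_const 2)) fun ω => ?_
        have a := hZ01 n i ω
        have b := hM1 n ω
        have h1 := mul_nonneg (sub_nonneg.2 hα1) a.1
        have h2 := mul_nonneg hα0 b.1
        have h3 := mul_le_mul_of_nonneg_left a.2 (sub_nonneg.2 hα1)
        have h4 := mul_le_mul_of_nonneg_left b.2 hα0
        have h5 : 0 ≤ (1 - α) * Z n i ω + α * walkMean Z n ω := by linarith
        have h6 : (1 - α) * Z n i ω + α * walkMean Z n ω ≤ 1 := by linarith
        constructor <;> nlinarith
      · intro ω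
        exact sum_p_ge hN α (fun i => Z n i ω) (fun i => hZ01 n i ω) _ rfl
    have h := (key n).2
    rw [hx' (n + 1), h]
    have e : C * r n ^ 2 * x n = (r n / N) ^ 2 * (N * (1 - (1 - α) ^ 2) * x n) := by
      rw [hC]; field_simp
    have := mul_le_mul_of_nonneg_left hge (sq_nonneg (r n / N))
    rw [← e] at this
    have := hx' n
    linarith
  have hC0 : 0 ≤ C := by
    rw [hC]; apply div_nonneg _ hN'.le; nlinarith
  have hC1 : C ≤ 1 := by
    rw [hC, div_le_one hN']; nlinarith [sq_nonneg (1 - α)]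
  have hfac : ∀ k, 0 ≤ 1 - C * (r k) ^ 2 := fun k => by
    have : r k ^ 2 ≤ 1 := pow_le_one₀ (hr k).1 (hr k).2.le
    nlinarith [sq_nonneg (r k)]
  have hprod : ∀ n, x n ≤ x 0 * ∏ k ∈ Finset.range n, (1 - C * (r k) ^ 2) := by
    intro n
    induction n with
    | zero => simp
    | succ n ih =>
      rw [Finset.prod_range_succ]
      have := mul_le_mul_of_nonneg_left ih (hfac n)
      linarith [hstep n]
  refine ⟨fun n => ⟨hx0 n, hstep n⟩, hprod, fun hαp hns => ?_⟩
  have hCp : 0 < C := by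
    rw [hC]; apply div_pos _ hN'; nlinarith
  have ht := (not_summable_iff_tendsto_nat_atTop_of_nonneg (fun n => sq_nonneg (r n))).1 hns
  have hexp : Tendsto (fun n => x 0 * Real.exp (-(C * ∑ k ∈ Finset.range n, r k ^ 2)))
      atTop (nhds 0) := by
    have := (Real.tendsto_exp_neg_atTop_nhds_zero.comp (ht.const_mul_atTop hCp)).const_mul (x 0)
    simpa using this
  refine squeeze_zero hx0 (fun n => (hprod n).trans ?_) hexp
  refine mul_le_mul_of_nonneg_left ?_ (hx0 0)
  rw [Finset.mul_sum, ← Finset.sum_neg_distrib, Real.exp_sum]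
  refine Finset.prod_le_prod (fun k _ => hfac k) fun k _ => ?_
  have := Real.add_one_le_exp (-(C * r k ^ 2))
  linarith
end
end
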